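/- Let e, e' be resource expressions with e ¨ e'. If the supports of their →∂-normal forms intersect, supp(NF(e)) ∩ supp(NF(e')) ≠ ∅, then e = e'. -/

import Mathlib

set_option maxHeartbeats 1000000

/-! ### Rigid resource terms -/

/-- Rigid resource terms (de Bruijn indices for variables):
`a ::= x | λ.a | ⟨a⟩b⃗ | a⊕• | •⊕a` where argument lists are ordered. -/
inductive Rt : Type
  | var : ℕ → Rt
  | lam : Rt → Rt
  | app : Rt → List Rt → Rt
  | inl : Rt → Rt
  | inr : Rt → Rt
deriving Inhabited

/-- Rigid resource expressions: terms or (rigid) monomials. -/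
abbrev REx : Type := Rt ⊕ List Rt

/-! ### Isomorphism of rigid expressions -/

mutual
  /-- Two rigid terms are isomorphic (`≅`) when they differ only by
  permutations of argument lists. -/
  inductive IsoT : Rt → Rt → Prop
    | var (x : ℕ) : IsoT (.var x) (.var x)
    | lam {a a'} : IsoT a a' → IsoT (.lam a) (.lam a')
    | inl {a a'} : IsoT a a' → IsoT (.inl a) (.inl a')
    | inr {a a'} : IsoT a a' → IsoT (.inr a) (.inr a')
    | app {c c' : Rt} {ds ds' : List Rt} :
        IsoT c c' → IsoM ds ds' → IsoT (.app c ds) (.app c' ds')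
  /-- Isomorphism of rigid monomials: a permutation `σ` together with
  isomorphisms `aᵢ ≅ a'_{σ(i)}`. -/
  inductive IsoM : List Rt → List Rt → Prop
    | mk (as as' : List Rt) (h : as'.length = as.length) (σ : Equiv.Perm (Fin as.length))
        (H : ∀ i : Fin as.length, IsoT (as.get i) (as'.get ((σ i).cast h.symm))) :
        IsoM as as'
end

/-! ### Resource expressions as quotients of rigid expressions -/

/-- Resource terms: rigid terms up to permutations of arguments, i.e. terms
whose argument lists are multisets. -/
def ResTerm : Type := Quot IsoT

instance : Inhabited ResTerm := ⟨Quot.mk _ (.var 0)⟩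

/-- The resource term represented by a rigid term (`r ◁ |r|`). -/
def rmk : Rt → ResTerm := Quot.mk IsoT

/-- A choice of rigid representation of a resource term. -/
noncomputable def rout : ResTerm → Rt := Quot.out

/-- The resource monomial (multiset) represented by a rigid monomial (list). -/
def toMul (bs : List Rt) : Multiset ResTerm := ↑(bs.map rmk)

/-- Resource expressions: terms or monomials (finite multisets of terms). -/
abbrev ResExpr : Type := ResTerm ⊕ Multiset ResTerm

/-- The resource expression represented by a rigid expression. -/
def toQ : REx → ResExpr := Sum.map rmk toMul

/-- A choice of rigid representation of a resource expression. -/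
noncomputable def outE : ResExpr → REx :=
  Sum.map rout (fun m => m.toList.map rout)

/-- Variable as a resource term. -/
def qVar (x : ℕ) : ResTerm := rmk (.var x)

/-- Abstraction on resource terms. -/
noncomputable def qLam (s : ResTerm) : ResTerm := rmk (.lam (rout s))

/-- Left injection `(-) ⊕ •` on resource terms. -/
noncomputable def qInl (s : ResTerm) : ResTerm := rmk (.inl (rout s))

/-- Right injection `• ⊕ (-)` on resource terms. -/
noncomputable def qInr (s : ResTerm) : ResTerm := rmk (.inr (rout s))

/-- Application `⟨s⟩t̄` of a resource term to a resource monomial. -/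
noncomputable def qApp (s : ResTerm) (t : Multiset ResTerm) : ResTerm :=
  rmk (.app (rout s) (t.toList.map rout))

/-! ### Coherence -/

mutual
  /-- Coherence on rigid resource terms. -/
  inductive CohT : Rt → Rt → Prop
    | var (x : ℕ) : CohT (.var x) (.var x)
    | lam {a a'} : CohT a a' → CohT (.lam a) (.lam a')
    | app {c c' : Rt} {ds ds' : List Rt} :
        CohT c c' → CohM ds ds' → CohT (.app c ds) (.app c' ds')
    | inl {a a'} : CohT a a' → CohT (.inl a) (.inl a')
    | inr {a a'} : CohT a a' → CohT (.inr a) (.inr a')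
    | mix (a a' : Rt) : CohT (.inl a) (.inr a')
  /-- Coherence on rigid monomials: all elements pairwise coherent. -/
  inductive CohM : List Rt → List Rt → Prop
    | mk {ds ds' : List Rt} (H : ∀ b ∈ ds ++ ds', ∀ b' ∈ ds ++ ds', CohT b b') :
        CohM ds ds'
end

/-- Coherence on rigid expressions. -/
def CohE : REx → REx → Prop
  | .inl a, .inl a' => CohT a a'
  | .inr l, .inr l' => CohM l l'
  | _, _ => False

/-! ### Coherence on resource expressions -/

/-- Coherence on resource terms. -/
def CohQT (s s' : ResTerm) : Prop :=
  ∃ a a', rmk a = s ∧ rmk a' = s' ∧ CohT a a'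

/-- Coherence on resource monomials. -/
def CohQM (m m' : Multiset ResTerm) : Prop :=
  ∃ bs bs', toMul bs = m ∧ toMul bs' = m' ∧ CohM bs bs'

/-- Coherence on resource expressions. -/
def CohQE : ResExpr → ResExpr → Prop
  | .inl s, .inl s' => CohQT s s'
  | .inr m, .inr m' => CohQM m m'
  | _, _ => False

/-! ### Occurrence counting and rigid substitution -/

namespace Rt

/-- Shift free de Bruijn indices `≥ c` up by one in a rigid term. -/
def shiftR (c : ℕ) : Rt → Rt
  | .var n => .var (if n < c then n else n + 1)
  | .lam a => .lam (a.shiftR (c + 1))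
  | .inl a => .inl (a.shiftR c)
  | .inr a => .inr (a.shiftR c)
  | .app d es => .app (d.shiftR c) (es.attach.map fun e => e.1.shiftR c)
termination_by r => sizeOf r
decreasing_by
  all_goals simp_wf
  all_goals try omega
  all_goals (have := List.sizeOf_lt_of_mem e.2; omega)

end Rt

/-- Number of free occurrences `n_x(a)` of the variable `x` in a rigid term. -/
def nx (x : ℕ) : Rt → ℕ
  | .var n => if n = x then 1 else 0
  | .lam a => nx (x + 1) a
  | .inl a => nx x a
  | .inr a => nx x a
  | .app d es => nx x d + (es.attach.map fun e => nx x e.1).sum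
termination_by r => sizeOf r
decreasing_by
  all_goals simp_wf
  all_goals try omega
  all_goals (have := List.sizeOf_lt_of_mem e.2; omega)

/-- Number of free occurrences of `x` in a rigid monomial. -/
def nxL (x : ℕ) (l : List Rt) : ℕ := (l.map (nx x)).sum

/-- Number of free occurrences of `x` in a rigid expression. -/
def nxE (x : ℕ) : REx → ℕ := Sum.elim (nx x) (nxL x)

mutual
  /-- Rigid substitution `r[b⃗/x]`: the occurrences of `x` in `r`, taken from
  left to right, are replaced by the successive elements of `b⃗`; it is
  undefined (`none`, i.e. the partial rigid expression `0`) unless `n_x(r) = |b⃗|`. -/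
  def rsubst : Rt → ℕ → List Rt → Option Rt
    | .var n, x, bs =>
        if n = x then (match bs with | [b] => some b | _ => none)
        else (match bs with
              | [] => some (.var (if x < n then n - 1 else n))
              | _ => none)
    | .lam a, x, bs => (rsubst a (x + 1) (bs.map (Rt.shiftR 0))).map .lam
    | .inl a, x, bs => (rsubst a x bs).map .inl
    | .inr a, x, bs => (rsubst a x bs).map .inr
    | .app c ds, x, bs =>
        match rsubst c x (bs.take (nx x c)), rsubstL ds x (bs.drop (nx x c)) with
        | some c', some ds' => some (.app c' ds')
        | _, _ => none
  /-- Rigid substitution in a rigid monomial. -/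
  def rsubstL : List Rt → ℕ → List Rt → Option (List Rt)
    | [], _, bs => (match bs with | [] => some [] | _ => none)
    | a :: as, x, bs =>
        match rsubst a x (bs.take (nx x a)), rsubstL as x (bs.drop (nx x a)) with
        | some a', some as' => some (a' :: as')
        | _, _ => none
end

/-- Rigid substitution on rigid expressions. -/
def rsubstE : REx → ℕ → List Rt → Option REx
  | .inl r, x, bs => (rsubst r x bs).map .inl
  | .inr l, x, bs => (rsubstL l x bs).map .inr

/-- Left action of a permutation on a list:
`σ·(b₁,…,bₙ) = (b_{σ⁻¹(1)},…,b_{σ⁻¹(n)})` (identity if the length is not `n`). -/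
def permList {α : Type*} {n : ℕ} (σ : Equiv.Perm (Fin n)) (l : List α) : List α :=
  if h : l.length = n then List.ofFn (fun j : Fin n => l.get ((σ.symm j).cast h.symm))
  else l

/-! ### Symmetric multilinear substitution -/

/-- Symmetric multilinear substitution computed on rigid representatives:
`∑_{σ ∈ S_n} |r[σ·b⃗/x]|`, as a finite ℕ-linear sum of resource expressions. -/
noncomputable def dsubRig (x : ℕ) (r : REx) (bs : List Rt) : ResExpr →₀ ℕ :=
  ∑ σ : Equiv.Perm (Fin bs.length),
    (rsubstE r x (permList σ bs)).elim 0 (fun u => Finsupp.single (toQ u) 1)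

/-- The symmetric multilinear substitution `∂_x e · t̄`, a finite ℕ-linear sum
of resource expressions. -/
noncomputable def dsub (x : ℕ) (e : ResExpr) (t : Multiset ResTerm) : ResExpr →₀ ℕ :=
  dsubRig x (outE e) (t.toList.map rout)

/-! ### Resource reduction -/

/-- Context `λx.(-)` applied to a sum element. -/
noncomputable def cLam : ResExpr → ResExpr
  | .inl s => .inl (qLam s)
  | e => e

/-- Context `(-)⊕•`. -/
noncomputable def cInl : ResExpr → ResExpr
  | .inl s => .inl (qInl s)
  | e => e

/-- Context `•⊕(-)`. -/
noncomputable def cInr : ResExpr → ResExpr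
  | .inl s => .inl (qInr s)
  | e => e

/-- Context `⟨-⟩t̄`. -/
noncomputable def cAppL (t : Multiset ResTerm) : ResExpr → ResExpr
  | .inl s => .inl (qApp s t)
  | e => e

/-- Context `⟨s⟩(-)`. -/
noncomputable def cAppR (s : ResTerm) : ResExpr → ResExpr
  | .inr m => .inl (qApp s m)
  | e => e

/-- Context `[-]·t̄`. -/
noncomputable def cMon (t : Multiset ResTerm) : ResExpr → ResExpr
  | .inl s => .inr (s ::ₘ t)
  | e => e

/-- One-step reduction `→∂` from resource expressions to finite ℕ-linear sums
of resource expressions. -/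
inductive Red : ResExpr → (ResExpr →₀ ℕ) → Prop
  | beta (s : ResTerm) (t : Multiset ResTerm) :
      Red (.inl (qApp (qLam s) t)) (dsub 0 (.inl s) t)
  | appInl (s : ResTerm) (t : Multiset ResTerm) :
      Red (.inl (qApp (qInl s) t)) (Finsupp.single (.inl (qInl (qApp s t))) 1)
  | appInr (s : ResTerm) (t : Multiset ResTerm) :
      Red (.inl (qApp (qInr s) t)) (Finsupp.single (.inl (qInr (qApp s t))) 1)
  | lamInl (s : ResTerm) :
      Red (.inl (qLam (qInl s))) (Finsupp.single (.inl (qInl (qLam s))) 1)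
  | lamInr (s : ResTerm) :
      Red (.inl (qLam (qInr s))) (Finsupp.single (.inl (qInr (qLam s))) 1)
  | lamCtx {s : ResTerm} {S : ResExpr →₀ ℕ} :
      Red (.inl s) S → Red (.inl (qLam s)) (S.mapDomain cLam)
  | appLCtx {s : ResTerm} {S : ResExpr →₀ ℕ} (t : Multiset ResTerm) :
      Red (.inl s) S → Red (.inl (qApp s t)) (S.mapDomain (cAppL t))
  | appRCtx {t : Multiset ResTerm} {T : ResExpr →₀ ℕ} (s : ResTerm) :
      Red (.inr t) T → Red (.inl (qApp s t)) (T.mapDomain (cAppR s))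
  | inlCtx {s : ResTerm} {S : ResExpr →₀ ℕ} :
      Red (.inl s) S → Red (.inl (qInl s)) (S.mapDomain cInl)
  | inrCtx {s : ResTerm} {S : ResExpr →₀ ℕ} :
      Red (.inl s) S → Red (.inl (qInr s)) (S.mapDomain cInr)
  | monCtx {s : ResTerm} {S : ResExpr →₀ ℕ} (t : Multiset ResTerm) :
      Red (.inl s) S → Red (.inr (s ::ₘ t)) (S.mapDomain (cMon t))

/-- Reduction `→∂` on finite ℕ-linear sums of resource expressions:
`e + F →∂ E₀ + F` whenever `e →∂ E₀`. -/
def RedS (E E' : ResExpr →₀ ℕ) : Prop :=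
  ∃ (e : ResExpr) (E₀ F : ResExpr →₀ ℕ),
    Red e E₀ ∧ E = Finsupp.single e 1 + F ∧ E' = E₀ + F

/-- The (unique) `→∂`-normal form of a resource expression: the normal sum
reachable from it (`→∂` being confluent and strongly normalizing). -/
noncomputable def NF (e : ResExpr) : ResExpr →₀ ℕ :=
  Classical.epsilon fun E =>
    Relation.ReflTransGen RedS (Finsupp.single e 1) E ∧ ∀ E', ¬ RedS E E'

/-! ### Rigid terms and isomorphism -/

/-- Structural induction on rigid terms. -/
theorem Rt.induct {P : Rt → Prop} (var : ∀ n, P (.var n)) (lam : ∀ a, P a → P (.lam a))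
    (app : ∀ c ds, P c → (∀ d ∈ ds, P d) → P (.app c ds))
    (inl : ∀ a, P a → P (.inl a)) (inr : ∀ a, P a → P (.inr a)) : ∀ r, P r
  | .var n => var n
  | .lam a => lam a (Rt.induct var lam app inl inr a)
  | .app c ds => app c ds (Rt.induct var lam app inl inr c)
      (fun d hd => by
        have := List.sizeOf_lt_of_mem hd
        exact Rt.induct var lam app inl inr d)
  | .inl a => inl a (Rt.induct var lam app inl inr a)
  | .inr a => inr a (Rt.induct var lam app inl inr a)
termination_by r => sizeOf r
decreasing_by all_goals simp_wf; try omega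

theorem List.Perm.exists_get_eq {α : Type*} {xs ys : List α} (p : xs.Perm ys)
    (h : ys.length = xs.length) :
    ∃ σ : Equiv.Perm (Fin xs.length), ∀ i, xs.get i = ys.get ((σ i).cast h.symm) := by
  classical
  have hinj : Function.Injective fun i : Fin xs.length => (p.idxBij i).cast h := fun i j hij =>
    p.subperm.idxInj_injective (Fin.cast_injective h hij)
  refine ⟨Equiv.ofBijective _ (Finite.injective_iff_bijective.1 hinj), fun i => ?_⟩
  simp

theorem IsoM.of_forall₂_perm {ds es ds' : List Rt} (h : List.Forall₂ IsoT ds es)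
    (p : es.Perm ds') : IsoM ds ds' := by
  have hlen : ds'.length = ds.length := (h.length_eq.trans p.length_eq).symm
  obtain ⟨σ, hσ⟩ := p.exists_get_eq p.length_eq.symm
  have e := h.length_eq
  refine .mk ds ds' hlen (((finCongr e).trans σ).trans (finCongr e.symm)) fun i => ?_
  have h1 := h.get i.2 (e ▸ i.2)
  have h2 := hσ (i.cast e)
  simp only [List.get_eq_getElem] at h1 h2 ⊢
  simp only [Fin.val_cast] at h2
  rw [h2] at h1
  simpa using h1

theorem IsoT.refl (a : Rt) : IsoT a a := by
  induction a using Rt.induct with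
  | var n => exact .var n
  | lam a ih => exact .lam ih
  | inl a ih => exact .inl ih
  | inr a ih => exact .inr ih
  | app c ds ihc ihd =>
    exact .app ihc (.of_forall₂_perm (List.forall₂_same.2 ihd) (List.Perm.refl _))

/-- Rule induction for `IsoT`, with isomorphism of monomials presented as a
pointwise isomorphism followed by a permutation. -/
theorem IsoT.induct {P : Rt → Rt → Prop} (var : ∀ x, P (.var x) (.var x))
    (lam : ∀ a a', P a a' → P (.lam a) (.lam a'))
    (inl : ∀ a a', P a a' → P (.inl a) (.inl a'))
    (inr : ∀ a a', P a a' → P (.inr a) (.inr a'))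
    (app : ∀ c c' ds es ds', P c c' → List.Forall₂ P ds es → es.Perm ds' →
      P (.app c ds) (.app c' ds')) {a a' : Rt} (h : IsoT a a') : P a a' := by
  induction h using IsoT.rec
    (motive_2 := fun ds ds' _ => ∃ es, List.Forall₂ P ds es ∧ es.Perm ds') with
  | var x => exact var x
  | lam _ ih => exact lam _ _ ih
  | inl _ ih => exact inl _ _ ih
  | inr _ ih => exact inr _ _ ih
  | app _ _ ihc ihd =>
    obtain ⟨es, h1, h2⟩ := ihd
    exact app _ _ _ es _ ihc h1 h2
  | mk as as' h σ _ ih =>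
    refine ⟨List.ofFn fun i => as'.get ((σ i).cast h.symm), ?_, ?_⟩
    · refine List.forall₂_iff_get.2 ⟨by simp, fun i h₁ h₂ => ?_⟩
      simpa using ih ⟨i, h₁⟩
    · refine (Equiv.Perm.ofFn_comp_perm σ fun i => as'.get (i.cast h.symm)).trans ?_
      refine List.Perm.of_eq (List.ext_get (by simp [h]) fun i h₁ h₂ => by simp)

/-! ### Constructors of resource terms -/

/-- The injection `(-) ⊕ •` or `• ⊕ (-)`, according to a Boolean. -/
noncomputable def qInj : Bool → ResTerm → ResTerm
  | false => qInl
  | true => qInr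

/-- The shape of a resource term, with its immediate subterms. -/
inductive TermView : Type
  | var : ℕ → TermView
  | lam : ResTerm → TermView
  | app : ResTerm → Multiset ResTerm → TermView
  | inj : Bool → ResTerm → TermView

/-- The shape of a rigid term. -/
def Rt.view : Rt → TermView
  | .var n => .var n
  | .lam a => .lam (rmk a)
  | .app c ds => .app (rmk c) (toMul ds)
  | .inl a => .inj false (rmk a)
  | .inr a => .inj true (rmk a)

theorem rmk_eq_of_iso {a a' : Rt} (h : IsoT a a') : rmk a = rmk a' := Quot.sound h

theorem toMul_eq_of_isoM {ds ds' : List Rt} (h : IsoM ds ds') : toMul ds = toMul ds' := by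
  obtain ⟨_, _, h, σ, H⟩ := h
  have : ds.map rmk = List.ofFn fun i => rmk (ds'.get ((σ i).cast h.symm)) :=
    List.ext_get (by simp) fun i h₁ h₂ => by
      simpa using rmk_eq_of_iso (H ⟨i, by simpa using h₁⟩)
  refine Multiset.coe_eq_coe.2 (this ▸ ?_)
  refine (Equiv.Perm.ofFn_comp_perm σ fun i => rmk (ds'.get (i.cast h.symm))).trans ?_
  exact List.Perm.of_eq (List.ext_get (by simp [h]) fun i h₁ h₂ => by simp)

/-- The shape of a resource term. -/
def qView : ResTerm → TermView :=
  Quot.lift Rt.view fun _ _ h => by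
    cases h with
    | var x => rfl
    | lam h => simp only [Rt.view, rmk_eq_of_iso h]
    | inl h => simp only [Rt.view, rmk_eq_of_iso h]
    | inr h => simp only [Rt.view, rmk_eq_of_iso h]
    | app h h' => simp only [Rt.view, rmk_eq_of_iso h, toMul_eq_of_isoM h']

theorem rmk_rout (s : ResTerm) : rmk (rout s) = s := Quot.out_eq s

theorem toMul_map_rout (t : Multiset ResTerm) : toMul (t.toList.map rout) = t := by
  simp [toMul, Function.comp_def, rmk_rout]

theorem qView_qVar (n : ℕ) : qView (qVar n) = .var n := rfl

theorem qView_qLam (s : ResTerm) : qView (qLam s) = .lam s :=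
  congrArg TermView.lam (rmk_rout s)

theorem qView_qApp (s : ResTerm) (t : Multiset ResTerm) : qView (qApp s t) = .app s t :=
  congrArg₂ TermView.app (rmk_rout s) (toMul_map_rout t)

theorem qView_qInj (c : Bool) (s : ResTerm) : qView (qInj c s) = .inj c s := by
  cases c
  · exact congrArg (TermView.inj false) (rmk_rout s)
  · exact congrArg (TermView.inj true) (rmk_rout s)

theorem eq_iff_of_view {s t : ResTerm} {p : Prop} (h : qView s = qView t → p) (h' : p → s = t) :
    s = t ↔ p := ⟨fun e => h (congrArg qView e), h'⟩

@[simp] theorem qVar_inj {m n : ℕ} : qVar m = qVar n ↔ m = n :=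
  eq_iff_of_view (by simp [qView_qVar]) (by rintro rfl; rfl)

@[simp] theorem qLam_inj {s t : ResTerm} : qLam s = qLam t ↔ s = t :=
  eq_iff_of_view (by simp [qView_qLam]) (by rintro rfl; rfl)

@[simp] theorem qApp_inj {s t : ResTerm} {m n : Multiset ResTerm} :
    qApp s m = qApp t n ↔ s = t ∧ m = n :=
  eq_iff_of_view (by simp [qView_qApp]) (by rintro ⟨rfl, rfl⟩; rfl)

@[simp] theorem qInj_inj {c d : Bool} {s t : ResTerm} : qInj c s = qInj d t ↔ c = d ∧ s = t :=
  eq_iff_of_view (by simp [qView_qInj]) (by rintro ⟨rfl, rfl⟩; rfl)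

theorem ne_of_view {s t : ResTerm} (h : qView s ≠ qView t) : s ≠ t := fun e => h (congrArg qView e)

@[simp] theorem qVar_ne_qLam {n s} : qVar n ≠ qLam s := ne_of_view (by simp [qView_qVar, qView_qLam])
@[simp] theorem qVar_ne_qApp {n s m} : qVar n ≠ qApp s m :=
  ne_of_view (by simp [qView_qVar, qView_qApp])
@[simp] theorem qVar_ne_qInj {n c s} : qVar n ≠ qInj c s :=
  ne_of_view (by simp [qView_qVar, qView_qInj])
@[simp] theorem qLam_ne_qVar {n s} : qLam s ≠ qVar n := qVar_ne_qLam.symm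
@[simp] theorem qLam_ne_qApp {r s m} : qLam r ≠ qApp s m :=
  ne_of_view (by simp [qView_qLam, qView_qApp])
@[simp] theorem qLam_ne_qInj {r c s} : qLam r ≠ qInj c s :=
  ne_of_view (by simp [qView_qLam, qView_qInj])
@[simp] theorem qApp_ne_qVar {n s m} : qApp s m ≠ qVar n := qVar_ne_qApp.symm
@[simp] theorem qApp_ne_qLam {r s m} : qApp s m ≠ qLam r := qLam_ne_qApp.symm
@[simp] theorem qApp_ne_qInj {r m c s} : qApp r m ≠ qInj c s :=
  ne_of_view (by simp [qView_qApp, qView_qInj])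
@[simp] theorem qInj_ne_qVar {n c s} : qInj c s ≠ qVar n := qVar_ne_qInj.symm
@[simp] theorem qInj_ne_qLam {r c s} : qInj c s ≠ qLam r := qLam_ne_qInj.symm
@[simp] theorem qInj_ne_qApp {r m c s} : qInj c s ≠ qApp r m := qApp_ne_qInj.symm

/-- Unary constructors compatible with isomorphism act on resource terms. -/
theorem rmk_congr {f : Rt → Rt} (hf : ∀ a a', IsoT a a' → IsoT (f a) (f a')) {a a' : Rt}
    (h : rmk a = rmk a') : rmk (f a) = rmk (f a') :=
  congrArg (Quot.lift (fun a => rmk (f a)) fun _ _ h => rmk_eq_of_iso (hf _ _ h)) h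

theorem rmk_app_congr {c c' : Rt} {ds ds' : List Rt} (hc : rmk c = rmk c')
    (hd : toMul ds = toMul ds') : rmk (.app c ds) = rmk (.app c' ds') := by
  have isoM_refl (ds : List Rt) : IsoM ds ds :=
    .of_forall₂_perm (List.forall₂_same.2 fun d _ => IsoT.refl d) (List.Perm.refl _)
  rw [rmk_congr (f := fun c => .app c ds) (fun _ _ h => .app h (isoM_refl ds)) hc]
  have key : ∀ {ds es : List Rt}, List.Forall₂ (fun d e => rmk d = rmk e) ds es →
      ∀ pre, rmk (.app c' (pre ++ ds)) = rmk (.app c' (pre ++ es)) := by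
    intro ds es h
    induction h with
    | nil => intro pre; rfl
    | @cons d e ds es h _ ih =>
      intro pre
      have h1 := rmk_congr (f := fun d => .app c' (pre ++ d :: ds)) (fun a a' h => .app (.refl _)
        (.of_forall₂_perm (List.rel_append (List.forall₂_same.2 fun d _ => IsoT.refl d)
          (.cons h (List.forall₂_same.2 fun d _ => IsoT.refl d))) (List.Perm.refl _))) h
      have h2 := ih (pre ++ [e])
      simp only [List.append_assoc, List.singleton_append] at h2
      exact h1.trans h2
  obtain ⟨es, h1, h2⟩ : ∃ es, List.Forall₂ (fun d e => rmk d = rmk e) ds es ∧ es.Perm ds' := by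
    have : Relation.Comp (List.Forall₂ fun d e => rmk d = rmk e) List.Perm ds ds' := by
      rw [List.forall₂_comp_perm_eq_perm_comp_forall₂]
      have hp : (ds.map rmk).Perm (ds'.map rmk) := Multiset.coe_eq_coe.1 hd
      have : Relation.Comp (List.Forall₂ fun d e => d = rmk e) List.Perm (ds.map rmk) ds' := by
        rw [List.forall₂_comp_perm_eq_perm_comp_forall₂]
        exact ⟨_, hp, by simp [List.forall₂_map_left_iff, List.forall₂_same]⟩
      obtain ⟨es, h1, h2⟩ := this
      rw [← List.forall₂_comp_perm_eq_perm_comp_forall₂]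
      exact ⟨es, List.forall₂_map_left_iff.1 h1, h2⟩
    exact this
  exact (key h1 []).trans (rmk_eq_of_iso (.app (.refl _)
    (.of_forall₂_perm (List.forall₂_same.2 fun d _ => IsoT.refl d) h2)))

theorem rmk_var (n : ℕ) : rmk (.var n) = qVar n := rfl

theorem rmk_lam (a : Rt) : rmk (.lam a) = qLam (rmk a) :=
  rmk_congr (fun _ _ => .lam) (rmk_rout _).symm

theorem rmk_inl (a : Rt) : rmk (.inl a) = qInj false (rmk a) :=
  rmk_congr (fun _ _ => .inl) (rmk_rout _).symm

theorem rmk_inr (a : Rt) : rmk (.inr a) = qInj true (rmk a) :=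
  rmk_congr (fun _ _ => .inr) (rmk_rout _).symm

theorem rmk_app (c : Rt) (ds : List Rt) : rmk (.app c ds) = qApp (rmk c) (toMul ds) :=
  rmk_app_congr (rmk_rout _).symm (toMul_map_rout _).symm

theorem mem_toMul {s : ResTerm} {ds : List Rt} : s ∈ toMul ds ↔ ∃ d ∈ ds, rmk d = s := by
  simp [toMul]

/-- Structural induction on resource terms. -/
@[elab_as_elim]
theorem ResTerm.induct {P : ResTerm → Prop} (var : ∀ n, P (qVar n)) (lam : ∀ s, P s → P (qLam s))
    (app : ∀ s t, P s → (∀ p ∈ t, P p) → P (qApp s t)) (inj : ∀ c s, P s → P (qInj c s))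
    (s : ResTerm) : P s := by
  induction s using Quot.ind with | _ a
  change P (rmk a)
  induction a using Rt.induct with
  | var n => exact var n
  | lam a ih => exact (rmk_lam a).symm ▸ lam _ ih
  | inl a ih => exact (rmk_inl a).symm ▸ inj _ _ ih
  | inr a ih => exact (rmk_inr a).symm ▸ inj _ _ ih
  | app c ds ihc ihd =>
    refine (rmk_app c ds).symm ▸ app _ _ ihc fun p hp => ?_
    obtain ⟨d, hd, rfl⟩ := mem_toMul.1 hp
    exact ihd d hd

/-! ### Shifting and weights -/

theorem shiftR_app (c : ℕ) (d : Rt) (es : List Rt) :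
    Rt.shiftR c (.app d es) = .app (d.shiftR c) (es.map (Rt.shiftR c)) := by
  simp [Rt.shiftR]

theorem toMul_map_congr {f : Rt → Rt} {ds es ds' : List Rt}
    (h : List.Forall₂ (fun d e => rmk (f d) = rmk (f e)) ds es) (p : es.Perm ds') :
    toMul (ds.map f) = toMul (ds'.map f) := by
  have h1 : (ds.map f).map rmk = (es.map f).map rmk := by
    clear p
    induction h with
    | nil => rfl
    | cons h _ ih => exact congrArg₂ List.cons h ih
  refine Multiset.coe_eq_coe.2 ?_
  rw [h1]
  exact (p.map f).map rmk

/-- Shift of the free indices `≥ c` of a resource term. -/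
def qShift (c : ℕ) : ResTerm → ResTerm :=
  Quot.lift (fun a => rmk (a.shiftR c)) fun a a' h => by
    refine IsoT.induct (P := fun a a' => ∀ c, rmk (a.shiftR c) = rmk (a'.shiftR c))
      (fun x c => rfl) ?_ ?_ ?_ ?_ h c
    · intro a a' ih c; simp only [Rt.shiftR, rmk_lam, ih]
    · intro a a' ih c; simp only [Rt.shiftR, rmk_inl, ih]
    · intro a a' ih c; simp only [Rt.shiftR, rmk_inr, ih]
    · intro d d' ds es ds' ihd h p c
      simp only [shiftR_app, rmk_app, ihd, toMul_map_congr (h.imp fun _ _ h => h c) p]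

theorem qShift_rmk (c : ℕ) (a : Rt) : qShift c (rmk a) = rmk (a.shiftR c) := rfl

theorem toMul_map_shiftR (c : ℕ) (ds : List Rt) :
    toMul (ds.map (Rt.shiftR c)) = (toMul ds).map (qShift c) := by
  simp [toMul, Function.comp_def, qShift_rmk]

@[simp] theorem qShift_qVar (c n : ℕ) : qShift c (qVar n) = qVar (if n < c then n else n + 1) := by
  rw [← rmk_var, qShift_rmk, Rt.shiftR, rmk_var]

@[simp] theorem qShift_qLam (c : ℕ) (s : ResTerm) : qShift c (qLam s) = qLam (qShift (c + 1) s) := by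
  obtain ⟨a, rfl⟩ : ∃ a, rmk a = s := ⟨_, rmk_rout s⟩
  rw [← rmk_lam, qShift_rmk, Rt.shiftR, rmk_lam, qShift_rmk]

@[simp] theorem qShift_qInj (c : ℕ) (b : Bool) (s : ResTerm) :
    qShift c (qInj b s) = qInj b (qShift c s) := by
  obtain ⟨a, rfl⟩ : ∃ a, rmk a = s := ⟨_, rmk_rout s⟩
  cases b
  · rw [← rmk_inl, qShift_rmk, Rt.shiftR, rmk_inl, qShift_rmk]
  · rw [← rmk_inr, qShift_rmk, Rt.shiftR, rmk_inr, qShift_rmk]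

@[simp] theorem qShift_qApp (c : ℕ) (s : ResTerm) (t : Multiset ResTerm) :
    qShift c (qApp s t) = qApp (qShift c s) (t.map (qShift c)) := by
  obtain ⟨a, rfl⟩ : ∃ a, rmk a = s := ⟨_, rmk_rout s⟩
  obtain ⟨ds, rfl⟩ : ∃ ds, toMul ds = t := ⟨_, toMul_map_rout t⟩
  rw [← rmk_app, qShift_rmk, shiftR_app, rmk_app, qShift_rmk, toMul_map_shiftR]

theorem qShift_injective (c : ℕ) : Function.Injective (qShift c) := by
  intro s
  induction s using ResTerm.induct generalizing c with
  | var n =>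
    intro s' h
    cases s' using ResTerm.induct with
    | var m => simp at h ⊢; split_ifs at h <;> omega
    | _ => simp at h
  | lam s ih =>
    intro s' h
    cases s' using ResTerm.induct with
    | lam s' _ => simp at h ⊢; exact ih _ h
    | _ => simp at h
  | inj b s ih =>
    intro s' h
    cases s' using ResTerm.induct with
    | inj b s' _ => simp at h ⊢; exact ⟨h.1, ih _ h.2⟩
    | _ => simp at h
  | app s t ihs iht =>
    intro s' h
    cases s' using ResTerm.induct with
    | app s' t' _ _ =>
      simp at h ⊢
      refine ⟨ihs _ h.1, Multiset.rel_eq.1 ?_⟩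
      have h2 := Multiset.rel_map.1 (Multiset.rel_eq.2 h.2)
      exact h2.mono fun p hp q _ hpq => iht p hp c hpq
    | _ => simp at h

theorem qShift_qShift {c d : ℕ} (h : c ≤ d) (s : ResTerm) :
    qShift (d + 1) (qShift c s) = qShift c (qShift d s) := by
  induction s using ResTerm.induct generalizing c d with
  | var n => simp; grind
  | lam s ih => simp [ih (Nat.succ_le_succ h)]
  | inj b s ih => simp [ih h]
  | app s t ihs iht =>
    simp only [qShift_qApp, ihs h, Multiset.map_map, qApp_inj, true_and]
    exact Multiset.map_congr rfl fun p hp => iht p hp h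

theorem map_qShift_map_qShift {c d : ℕ} (h : c ≤ d) (t : Multiset ResTerm) :
    (t.map (qShift c)).map (qShift (d + 1)) = (t.map (qShift d)).map (qShift c) := by
  simp only [Multiset.map_map, Function.comp_def, qShift_qShift h]

/-- A weight on rigid terms; `k = 1` gives the size, and for `k = 2` the weight
decreases when sums are extracted from abstractions and applications. -/
def Rt.weight (k : ℕ) : Rt → ℕ
  | .var _ => 1
  | .lam a => k * a.weight k + 1
  | .inl a => a.weight k + 1
  | .inr a => a.weight k + 1
  | .app d es => k * d.weight k + (es.attach.map fun e => e.1.weight k).sum + 1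
termination_by r => sizeOf r
decreasing_by
  all_goals simp_wf
  all_goals try omega
  all_goals (have := List.sizeOf_lt_of_mem e.2; omega)

theorem Rt.weight_app (k : ℕ) (d : Rt) (es : List Rt) :
    Rt.weight k (.app d es) = k * d.weight k + (es.map (Rt.weight k)).sum + 1 := by
  rw [Rt.weight, List.attach_map_val (f := Rt.weight k)]

/-- The weight of a resource term. -/
def qWeight (k : ℕ) : ResTerm → ℕ :=
  Quot.lift (Rt.weight k) fun a a' h => by
    refine IsoT.induct (P := fun a a' => Rt.weight k a = Rt.weight k a')
      (fun x => rfl) ?_ ?_ ?_ ?_ h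
    · intro a a' ih; simp only [Rt.weight, ih]
    · intro a a' ih; simp only [Rt.weight, ih]
    · intro a a' ih; simp only [Rt.weight, ih]
    · intro d d' ds es ds' ihd h p
      have h1 : ds.map (Rt.weight k) = es.map (Rt.weight k) := by
        rw [← List.forall₂_eq_eq_eq, List.forall₂_map_left_iff, List.forall₂_map_right_iff]
        exact h
      rw [Rt.weight_app, Rt.weight_app, ihd, h1, (p.map _).sum_eq]

/-- The weight of a resource monomial. -/
def mWeight (k : ℕ) (t : Multiset ResTerm) : ℕ := (t.map (qWeight k)).sum

@[simp] theorem qWeight_qVar (k n : ℕ) : qWeight k (qVar n) = 1 := by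
  change Rt.weight k _ = _
  rw [Rt.weight]

theorem qWeight_rmk (k : ℕ) (a : Rt) : qWeight k (rmk a) = a.weight k := rfl

@[simp] theorem qWeight_qLam (k : ℕ) (s : ResTerm) : qWeight k (qLam s) = k * qWeight k s + 1 := by
  obtain ⟨a, rfl⟩ : ∃ a, rmk a = s := ⟨_, rmk_rout s⟩
  rw [← rmk_lam, qWeight_rmk, qWeight_rmk, Rt.weight]

@[simp] theorem qWeight_qInj (k : ℕ) (b : Bool) (s : ResTerm) :
    qWeight k (qInj b s) = qWeight k s + 1 := by
  obtain ⟨a, rfl⟩ : ∃ a, rmk a = s := ⟨_, rmk_rout s⟩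
  cases b
  · rw [← rmk_inl, qWeight_rmk, qWeight_rmk, Rt.weight]
  · rw [← rmk_inr, qWeight_rmk, qWeight_rmk, Rt.weight]

@[simp] theorem qWeight_qApp (k : ℕ) (s : ResTerm) (t : Multiset ResTerm) :
    qWeight k (qApp s t) = k * qWeight k s + mWeight k t + 1 := by
  obtain ⟨a, rfl⟩ : ∃ a, rmk a = s := ⟨_, rmk_rout s⟩
  obtain ⟨ds, rfl⟩ : ∃ ds, toMul ds = t := ⟨_, toMul_map_rout t⟩
  rw [← rmk_app, qWeight_rmk, qWeight_rmk, Rt.weight_app]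
  simp [mWeight, toMul, Function.comp_def, qWeight_rmk]

@[simp] theorem mWeight_cons (k : ℕ) (s : ResTerm) (t : Multiset ResTerm) :
    mWeight k (s ::ₘ t) = qWeight k s + mWeight k t := by simp [mWeight]

@[simp] theorem mWeight_add (k : ℕ) (s t : Multiset ResTerm) :
    mWeight k (s + t) = mWeight k s + mWeight k t := by simp [mWeight]

@[simp] theorem mWeight_singleton (k : ℕ) (s : ResTerm) : mWeight k {s} = qWeight k s := by
  simp [mWeight]

@[simp] theorem qWeight_qShift (k c : ℕ) (s : ResTerm) : qWeight k (qShift c s) = qWeight k s := by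
  induction s using ResTerm.induct generalizing c with
  | var n => simp
  | lam s ih => simp [ih]
  | inj b s ih => simp [ih]
  | app s t ihs iht =>
    simp only [qShift_qApp, qWeight_qApp, ihs, mWeight, Multiset.map_map, Function.comp_def]
    rw [Multiset.map_congr (g := qWeight k) rfl fun p hp => iht p hp c]

@[simp] theorem mWeight_map_qShift (k c : ℕ) (t : Multiset ResTerm) :
    mWeight k (t.map (qShift c)) = mWeight k t := by simp [mWeight]

/-! ### Substitution as a relation on resource terms -/

theorem Multiset.exists_cons_of_map_eq_cons {α β : Type*} {f : α → β} {s : Multiset α}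
    {t : Multiset β} {b : β} (h : s.map f = b ::ₘ t) :
    ∃ a s', s = a ::ₘ s' ∧ f a = b ∧ s'.map f = t := by
  classical
  obtain ⟨a, ha, hb, ht⟩ := (Multiset.map_eq_cons f s t b).2 h
  exact ⟨a, s.erase a, (Multiset.cons_erase ha).symm, hb, ht⟩

/-- The elementwise extension to multisets of a ternary relation whose middle
argument is a multiset, the middle arguments being added up. -/
inductive Mon3 {α β γ : Type*} (R : α → Multiset β → γ → Prop) :
    Multiset α → Multiset β → Multiset γ → Prop
  | nil : Mon3 R 0 0 0
  | cons {a t u m ts us} : R a t u → Mon3 R m ts us → Mon3 R (a ::ₘ m) (t + ts) (u ::ₘ us)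

namespace Mon3

variable {α β γ : Type*} {R S : α → Multiset β → γ → Prop} {m m' : Multiset α}
  {t t' : Multiset β} {w w' : Multiset γ}

theorem of_list (L : Multiset (α × Multiset β × γ)) (h : ∀ p ∈ L, R p.1 p.2.1 p.2.2) :
    Mon3 R (L.map (·.1)) (L.map (·.2.1)).sum (L.map (·.2.2)) := by
  induction L using Multiset.induction with
  | empty => exact .nil
  | cons p L ih =>
    simp only [Multiset.map_cons, Multiset.sum_cons]
    exact .cons (h _ (by simp)) (ih fun q hq => h q (by simp [hq]))

theorem exists_list (h : Mon3 R m t w) : ∃ L : Multiset (α × Multiset β × γ),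
    (∀ p ∈ L, R p.1 p.2.1 p.2.2) ∧
      m = L.map (·.1) ∧ t = (L.map (·.2.1)).sum ∧ w = L.map (·.2.2) := by
  induction h with
  | nil => exact ⟨0, by simp⟩
  | @cons a t u m ts us h _ ih =>
    obtain ⟨L, hL, rfl, rfl, rfl⟩ := ih
    exact ⟨(a, t, u) ::ₘ L, by simpa using ⟨h, fun x y z hp => hL _ hp⟩, by simp, by simp, by simp⟩

theorem add (h : Mon3 R m t w) (h' : Mon3 R m' t' w') : Mon3 R (m + m') (t + t') (w + w') := by
  induction h with
  | nil => simpa using h'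
  | cons h _ ih => simpa only [Multiset.cons_add, add_assoc] using cons h ih

theorem single {a u} (h : R a t u) : Mon3 R {a} t {u} := by
  simpa using cons h nil

theorem zero_inv (h : Mon3 R 0 t w) : t = 0 ∧ w = 0 := by
  obtain ⟨L, -, h1, rfl, rfl⟩ := h.exists_list
  obtain rfl := Multiset.map_eq_zero.1 h1.symm
  simp

theorem cons_inv {a : α} (h : Mon3 R (a ::ₘ m) t w) :
    ∃ t₁ t₂ u w', t = t₁ + t₂ ∧ w = u ::ₘ w' ∧ R a t₁ u ∧ Mon3 R m t₂ w' := by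
  obtain ⟨L, hL, h1, rfl, rfl⟩ := h.exists_list
  obtain ⟨p, L, rfl, rfl, rfl⟩ := Multiset.exists_cons_of_map_eq_cons h1.symm
  exact ⟨p.2.1, _, p.2.2, _, by simp, by simp, hL p (by simp),
    .of_list L fun q hq => hL q (by simp [hq])⟩

theorem map {α' β' γ' : Type*} {R' : α' → Multiset β' → γ' → Prop} {f : α → α'} {g : β → β'}
    {k : γ → γ'} (h : Mon3 R m t w)
    (H : ∀ a ∈ m, ∀ t u, R a t u → R' (f a) (t.map g) (k u)) :
    Mon3 R' (m.map f) (t.map g) (w.map k) := by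
  induction h with
  | nil => exact .nil
  | cons h _ ih =>
    simp only [Multiset.map_cons, Multiset.map_add]
    exact .cons (H _ (by simp) _ _ h) (ih fun a ha => H a (by simp [ha]))

end Mon3

theorem Multiset.map_eq_add_iff {α β : Type*} {f : α → β} {T : Multiset α} {A B : Multiset β} :
    T.map f = A + B ↔ ∃ T₁ T₂, T = T₁ + T₂ ∧ T₁.map f = A ∧ T₂.map f = B := by
  constructor
  · induction A using Multiset.induction generalizing T with
    | empty => exact fun h => ⟨0, T, by simp, rfl, by simpa using h⟩
    | cons a A ih =>
      intro h
      rw [Multiset.cons_add] at h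
      obtain ⟨a, T, rfl, rfl, h'⟩ := Multiset.exists_cons_of_map_eq_cons h
      obtain ⟨T₁, T₂, rfl, rfl, rfl⟩ := ih h'
      exact ⟨a ::ₘ T₁, T₂, by simp, by simp, rfl⟩
  · rintro ⟨T₁, T₂, rfl, rfl, rfl⟩
    simp

/-- `QSub x s t u` holds when `u` occurs in `∂_x s · t`. -/
inductive QSub : ℕ → ResTerm → Multiset ResTerm → ResTerm → Prop
  | hit (x : ℕ) (t : ResTerm) : QSub x (qVar x) {t} t
  | miss (x n : ℕ) : n ≠ x → QSub x (qVar n) 0 (qVar (if x < n then n - 1 else n))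
  | lam {x s t u} : QSub (x + 1) s (t.map (qShift 0)) u → QSub x (qLam s) t (qLam u)
  | inj {x s t u} (c : Bool) : QSub x s t u → QSub x (qInj c s) t (qInj c u)
  | app' {x s t u} (L : Multiset (ResTerm × Multiset ResTerm × ResTerm)) :
      QSub x s t u → (∀ p ∈ L, QSub x p.1 p.2.1 p.2.2) →
      QSub x (qApp s (L.map (·.1))) (t + (L.map (·.2.1)).sum) (qApp u (L.map (·.2.2)))

namespace QSub

theorem app {x s t u m ts us} (h : QSub x s t u) (h' : Mon3 (QSub x) m ts us) :
    QSub x (qApp s m) (t + ts) (qApp u us) := by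
  obtain ⟨L, hL, rfl, rfl, rfl⟩ := h'.exists_list
  exact .app' L h hL

theorem var_inv {x n t u} (h : QSub x (qVar n) t u) :
    (n = x ∧ t = {u}) ∨ (n ≠ x ∧ t = 0 ∧ u = qVar (if x < n then n - 1 else n)) := by
  generalize hs : qVar n = s at h
  cases h <;> simp_all

theorem lam_inv {x s t u} (h : QSub x (qLam s) t u) :
    ∃ v, u = qLam v ∧ QSub (x + 1) s (t.map (qShift 0)) v := by
  generalize hs : qLam s = r at h
  cases h <;> simp_all

theorem inj_inv {x c s t u} (h : QSub x (qInj c s) t u) : ∃ v, u = qInj c v ∧ QSub x s t v := by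
  generalize hs : qInj c s = r at h
  cases h <;> simp_all

theorem app_inv {x s m t u} (h : QSub x (qApp s m) t u) :
    ∃ t₁ t₂ v w, t = t₁ + t₂ ∧ u = qApp v w ∧ QSub x s t₁ v ∧ Mon3 (QSub x) m t₂ w := by
  generalize hs : qApp s m = r at h
  cases h with
  | app' L h hL =>
    simp only [qApp_inj] at hs
    obtain ⟨rfl, rfl⟩ := hs
    exact ⟨_, _, _, _, rfl, rfl, h, .of_list L hL⟩
  | _ => simp at hs

end QSub

theorem Mon3.sub_weight {x m t w} (h : Mon3 (fun s t u => QSub x s t u ∧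
    qWeight 1 u ≤ qWeight 1 s + mWeight 1 t) m t w) : mWeight 1 w ≤ mWeight 1 m + mWeight 1 t := by
  induction h with
  | nil => simp
  | cons h _ ih =>
    simp only [mWeight_cons, mWeight_add]
    have := h.2
    omega

theorem QSub.weight_le {x s t u} (h : QSub x s t u) :
    qWeight 1 u ≤ qWeight 1 s + mWeight 1 t := by
  induction h with
  | hit x t => simp
  | miss => simp
  | lam h ih => simp at ih ⊢; omega
  | inj c h ih => simp; omega
  | app' L h hL ih ihL =>
    have := (Mon3.of_list (R := fun s t u => QSub _ s t u ∧ qWeight 1 u ≤ qWeight 1 s + mWeight 1 t)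
      L fun p hp => ⟨hL p hp, ihL p hp⟩).sub_weight
    simp at this ⊢
    omega

theorem QSub.shift_self (y : ℕ) (s : ResTerm) : QSub y (qShift y s) 0 s := by
  induction s using ResTerm.induct generalizing y with
  | var n =>
    rw [qShift_qVar]
    have := QSub.miss y (if n < y then n else n + 1) (by split_ifs <;> omega)
    convert this using 2
    split_ifs <;> omega
  | lam s ih => rw [qShift_qLam]; exact .lam (ih _)
  | inj c s ih => rw [qShift_qInj]; exact .inj c (ih _)
  | app s t ihs iht =>
    rw [qShift_qApp]
    refine (ihs y).app (ts := 0) ?_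
    clear ihs
    induction t using Multiset.induction with
    | empty => exact .nil
    | cons a t ih =>
      rw [Multiset.map_cons]
      exact .cons (t := 0) (iht a (by simp) y) (ih fun p hp => iht p (by simp [hp]))

theorem QSub.shift {y c s t u} (hyc : y ≤ c) (h : QSub y s t u) :
    QSub y (qShift (c + 1) s) (t.map (qShift c)) (qShift c u) := by
  induction s using ResTerm.induct generalizing y c t u with
  | var n =>
    rcases h.var_inv with ⟨rfl, rfl⟩ | ⟨hn, rfl, rfl⟩
    · rw [qShift_qVar, if_pos (by omega)]
      exact .hit _ _
    · have := QSub.miss y (if n < c + 1 then n else n + 1) (by split_ifs <;> omega)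
      rw [qShift_qVar, qShift_qVar]
      convert this using 2
      congr 1
      split_ifs <;> omega
  | lam s ih =>
    obtain ⟨v, rfl, h'⟩ := h.lam_inv
    rw [qShift_qLam, qShift_qLam]
    refine .lam ?_
    rw [← map_qShift_map_qShift (Nat.zero_le c)]
    exact ih (Nat.succ_le_succ hyc) h'
  | inj c s ih =>
    obtain ⟨v, rfl, h'⟩ := h.inj_inv
    rw [qShift_qInj, qShift_qInj]
    exact .inj _ (ih hyc h')
  | app s m ihs ihm =>
    obtain ⟨t₁, t₂, v, w, rfl, rfl, h1, h2⟩ := h.app_inv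
    rw [qShift_qApp, qShift_qApp, Multiset.map_add]
    exact .app (ihs hyc h1) (h2.map fun a ha t u h => ihm a ha hyc h)

theorem Mon3.exists_of_shift {R S : ResTerm → Multiset ResTerm → ResTerm → Prop} {y : ℕ}
    {m T w : Multiset ResTerm} (h : Mon3 R (m.map (qShift y)) (T.map (qShift y)) w)
    (H : ∀ s ∈ m, ∀ T u, R (qShift y s) (T.map (qShift y)) u → ∃ v, u = qShift y v ∧ S s T v) :
    ∃ w₀, w = w₀.map (qShift y) ∧ Mon3 S m T w₀ := by
  induction m using Multiset.induction generalizing T w with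
  | empty =>
    obtain ⟨h1, rfl⟩ := zero_inv (by simpa using h)
    obtain rfl := Multiset.map_eq_zero.1 h1
    exact ⟨0, by simp, .nil⟩
  | cons a m ih =>
    rw [Multiset.map_cons] at h
    obtain ⟨t₁, t₂, u, w', h1, rfl, h2, h3⟩ := h.cons_inv
    obtain ⟨T₁, T₂, rfl, rfl, rfl⟩ := Multiset.map_eq_add_iff.1 h1
    obtain ⟨v, rfl, h4⟩ := H a (by simp) _ _ h2
    obtain ⟨w₀, rfl, h5⟩ := ih h3 fun s hs => H s (by simp [hs])
    exact ⟨v ::ₘ w₀, by simp, .cons h4 h5⟩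

theorem QSub.exists_of_shift {x y s T u} (hyx : y ≤ x)
    (h : QSub (x + 1) (qShift y s) (T.map (qShift y)) u) : ∃ v, u = qShift y v ∧ QSub x s T v := by
  induction s using ResTerm.induct generalizing x y T u with
  | var n =>
    rw [qShift_qVar] at h
    rcases h.var_inv with ⟨hn, hT⟩ | ⟨hn, hT, rfl⟩
    · obtain ⟨t, rfl, rfl⟩ := Multiset.map_eq_singleton.1 hT
      obtain rfl : n = x := by split_ifs at hn <;> omega
      exact ⟨t, rfl, .hit _ _⟩
    · obtain rfl := Multiset.map_eq_zero.1 hT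
      refine ⟨_, ?_, .miss x n (by split_ifs at hn <;> omega)⟩
      rw [qShift_qVar, qVar_inj]
      split_ifs at hn ⊢ <;> omega
  | lam s ih =>
    rw [qShift_qLam] at h
    obtain ⟨v, rfl, h'⟩ := h.lam_inv
    rw [← map_qShift_map_qShift (Nat.zero_le y)] at h'
    obtain ⟨v, rfl, h''⟩ := ih (Nat.succ_le_succ hyx) h'
    exact ⟨qLam v, by simp, .lam h''⟩
  | inj c s ih =>
    rw [qShift_qInj] at h
    obtain ⟨v, rfl, h'⟩ := h.inj_inv
    obtain ⟨v, rfl, h''⟩ := ih hyx h'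
    exact ⟨qInj c v, by simp, .inj c h''⟩
  | app s m ihs ihm =>
    rw [qShift_qApp] at h
    obtain ⟨t₁, t₂, v, w, h1, rfl, h2, h3⟩ := h.app_inv
    obtain ⟨T₁, T₂, rfl, rfl, rfl⟩ := Multiset.map_eq_add_iff.1 h1
    obtain ⟨v, rfl, h4⟩ := ihs hyx h2
    obtain ⟨w, rfl, h5⟩ := h3.exists_of_shift fun s hs T u h => ihm s hs hyx h
    exact ⟨qApp v w, by simp, .app h4 h5⟩

/-- Elementwise form of `QSub.comp`. -/
theorem Mon3.sub_comp {R A B C : ResTerm → Multiset ResTerm → ResTerm → Prop} {g : ResTerm → ResTerm}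
    {D : ResTerm → Multiset ResTerm → ResTerm → Prop}
    {p q s t h : Multiset ResTerm} (h₁ : Mon3 R p q s) (h₂ : Mon3 A s t h)
    (H : ∀ p₀ ∈ p, ∀ q s t h, R p₀ q s → A s t h → ∃ t₁ t₂ p₁ q₁, t = t₁ + t₂ ∧
      B p₀ (t₁.map g) p₁ ∧ Mon3 C q t₂ q₁ ∧ D p₁ q₁ h) :
    ∃ t₁ t₂ p₁ q₁, t = t₁ + t₂ ∧ Mon3 B p (t₁.map g) p₁ ∧ Mon3 C q t₂ q₁ ∧ Mon3 D p₁ q₁ h := by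
  induction h₁ generalizing t h with
  | nil =>
    obtain ⟨rfl, rfl⟩ := h₂.zero_inv
    exact ⟨0, 0, 0, 0, rfl, .nil, .nil, .nil⟩
  | cons h₁ _ ih =>
    obtain ⟨t₁, t₂, u, w', rfl, rfl, h3, h4⟩ := h₂.cons_inv
    obtain ⟨a₁, a₂, p₁, q₁, rfl, b1, b2, b3⟩ := H _ (by simp) _ _ _ _ h₁ h3
    obtain ⟨c₁, c₂, p₂, q₂, rfl, d1, d2, d3⟩ := ih h4 fun p hp => H p (by simp [hp])
    exact ⟨a₁ + c₁, a₂ + c₂, p₁ ::ₘ p₂, q₁ + q₂, add_add_add_comm _ _ _ _,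
      by simpa using Mon3.cons b1 d1, b2.add d2, .cons b3 d3⟩

/-- The substitution lemma. -/
theorem QSub.comp {x y p q s t h} (hyx : y ≤ x) (h₁ : QSub y p q s) (h₂ : QSub x s t h) :
    ∃ t₁ t₂ p₁ q₁, t = t₁ + t₂ ∧ QSub (x + 1) p (t₁.map (qShift y)) p₁ ∧
      Mon3 (QSub x) q t₂ q₁ ∧ QSub y p₁ q₁ h := by
  induction p using ResTerm.induct generalizing x y q s t h with
  | var n =>
    rcases h₁.var_inv with ⟨rfl, rfl⟩ | ⟨hn, rfl, rfl⟩
    · refine ⟨0, t, _, {h}, by simp, .miss _ n (by omega), .single h₂, ?_⟩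
      rw [if_neg (by omega)]
      exact .hit _ _
    · rcases h₂.var_inv with ⟨hx, rfl⟩ | ⟨hx, rfl, rfl⟩
      · obtain rfl : n = x + 1 := by split_ifs at hx <;> omega
        exact ⟨{h}, 0, _, 0, by simp, .hit _ _, .nil, .shift_self _ _⟩
      · refine ⟨0, 0, _, 0, by simp, .miss _ n ?_, .nil, ?_⟩
        · split_ifs at hx <;> omega
        · have := QSub.miss y (if x + 1 < n then n - 1 else n)
            (by split_ifs at hx ⊢ <;> omega)
          convert this using 2
          split_ifs at hx ⊢ <;> omega
  | lam p ih =>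
    obtain ⟨s, rfl, a1⟩ := h₁.lam_inv
    obtain ⟨h, rfl, a2⟩ := h₂.lam_inv
    obtain ⟨t₁, t₂, p₁, q₁, e, h3, h4, h5⟩ := ih (Nat.succ_le_succ hyx) a1 a2
    obtain ⟨t₁, t₂, rfl, rfl, rfl⟩ := Multiset.map_eq_add_iff.1 e
    obtain ⟨q₁, rfl, h6⟩ := h4.exists_of_shift fun s _ T u h => h.exists_of_shift (Nat.zero_le x)
    rw [map_qShift_map_qShift (Nat.zero_le y)] at h3
    exact ⟨t₁, t₂, _, q₁, rfl, .lam h3, h6, .lam h5⟩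
  | inj c p ih =>
    obtain ⟨s, rfl, a1⟩ := h₁.inj_inv
    obtain ⟨h, rfl, a2⟩ := h₂.inj_inv
    obtain ⟨t₁, t₂, p₁, q₁, rfl, h3, h4, h5⟩ := ih hyx a1 a2
    exact ⟨t₁, t₂, _, q₁, rfl, .inj c h3, h4, .inj c h5⟩
  | app p m ihp ihm =>
    obtain ⟨q, q', s, s', rfl, rfl, a1, a2⟩ := h₁.app_inv
    obtain ⟨t, t', h, h', rfl, rfl, b1, b2⟩ := h₂.app_inv
    obtain ⟨t₁, t₂, p₁, q₁, rfl, h3, h4, h5⟩ := ihp hyx a1 b1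
    obtain ⟨t₁', t₂', p₁', q₁', rfl, h3', h4', h5'⟩ := a2.sub_comp b2
      fun p hp q s t h h₁ h₂ => ihm p hp hyx h₁ h₂
    refine ⟨t₁ + t₁', t₂ + t₂', _, q₁ + q₁', add_add_add_comm _ _ _ _, ?_, h4.add h4', h5.app h5'⟩
    rw [Multiset.map_add]
    exact h3.app h3'

/-! ### Reduction to a single summand -/

theorem Multiset.cons_eq_add {α : Type*} {a : α} {s t₁ t₂ : Multiset α} (h : a ::ₘ s = t₁ + t₂) :
    (∃ r, t₁ = a ::ₘ r ∧ s = r + t₂) ∨ ∃ r, t₂ = a ::ₘ r ∧ s = t₁ + r := by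
  have ha : a ∈ t₁ + t₂ := h ▸ Multiset.mem_cons_self a s
  rcases Multiset.mem_add.1 ha with ha | ha <;> obtain ⟨r, rfl⟩ := Multiset.exists_cons_of_mem ha
  · exact .inl ⟨r, rfl, by simpa using h⟩
  · exact .inr ⟨r, rfl, by simpa using h⟩

/-- `Step s s'` holds when `s` reduces in one step to a sum having `s'` as a summand. -/
inductive Step : ResTerm → ResTerm → Prop
  | beta {s t u} : QSub 0 s t u → Step (qApp (qLam s) t) u
  | appInj (c s t) : Step (qApp (qInj c s) t) (qInj c (qApp s t))
  | lamInj (c s) : Step (qLam (qInj c s)) (qInj c (qLam s))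
  | lam {s s'} : Step s s' → Step (qLam s) (qLam s')
  | inj (c) {s s'} : Step s s' → Step (qInj c s) (qInj c s')
  | appL (t) {s s'} : Step s s' → Step (qApp s t) (qApp s' t)
  | appR (s t) {p p'} : Step p p' → Step (qApp s (p ::ₘ t)) (qApp s (p' ::ₘ t))

/-- Reduction of one element of a multiset. -/
inductive StepM : Multiset ResTerm → Multiset ResTerm → Prop
  | mk {p p'} (t) : Step p p' → StepM (p ::ₘ t) (p' ::ₘ t)

theorem StepM.cons (a : ResTerm) {t t'} (h : StepM t t') : StepM (a ::ₘ t) (a ::ₘ t') := by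
  obtain ⟨t, h⟩ := h
  rw [Multiset.cons_swap a, Multiset.cons_swap a]
  exact .mk _ h

theorem Step.app (s : ResTerm) {t t'} (h : StepM t t') : Step (qApp s t) (qApp s t') := by
  obtain ⟨t, h⟩ := h
  exact .appR s t h

theorem Step.shift {s s' : ResTerm} (h : Step s s') (c : ℕ) :
    Step (qShift c s) (qShift c s') := by
  induction h generalizing c with
  | beta h =>
    rw [qShift_qApp, qShift_qLam]
    exact .beta (h.shift (Nat.zero_le c))
  | appInj => simpa using .appInj _ _ _
  | lamInj => simpa using .lamInj _ _
  | lam _ ih => simpa using .lam (ih _)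
  | inj d _ ih => simpa using .inj d (ih _)
  | appL t _ ih => simpa using .appL _ (ih _)
  | appR s t _ ih => simpa using .appR _ _ (ih _)

/-- The well-founded order which one-step reduction decreases. -/
def Smaller (s' s : ResTerm) : Prop :=
  qWeight 1 s' < qWeight 1 s ∨ (qWeight 1 s' = qWeight 1 s ∧ qWeight 2 s' < qWeight 2 s)

theorem Smaller.wf : WellFounded Smaller := by
  refine Subrelation.wf (r := InvImage (Prod.Lex (· < ·) (· < ·))
    fun s => (qWeight 1 s, qWeight 2 s)) (fun {s' s} h => ?_)
    (InvImage.wf _ (IsWellFounded.wf : WellFounded (Prod.Lex (· < · : ℕ → ℕ → Prop) (· < ·))))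
  simpa [InvImage, Prod.lex_def, Smaller] using h

theorem Step.smaller {s s' : ResTerm} (h : Step s s') : Smaller s' s := by
  unfold Smaller
  induction h with
  | beta h => have := h.weight_le; simp; omega
  | _ => simp; try omega

theorem Mon3.exists_stepM {R : ResTerm → Multiset ResTerm → ResTerm → Prop} {t t' : ResTerm}
    {m ts us : Multiset ResTerm} (h : Mon3 R m (t' ::ₘ ts) us)
    (H : ∀ s ∈ m, ∀ ts u, R s (t' ::ₘ ts) u → ∃ f, R s (t ::ₘ ts) f ∧ Step f u) :
    ∃ us', Mon3 R m (t ::ₘ ts) us' ∧ StepM us' us := by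
  induction m using Multiset.induction generalizing ts us with
  | empty => simpa using h.zero_inv.1
  | cons a m ih =>
    obtain ⟨t₁, t₂, u, w, e, rfl, h1, h2⟩ := h.cons_inv
    rcases Multiset.cons_eq_add e with ⟨r, rfl, rfl⟩ | ⟨r, rfl, rfl⟩
    · obtain ⟨f, h3, h4⟩ := H a (by simp) _ _ h1
      exact ⟨f ::ₘ w, by simpa using Mon3.cons h3 h2, .mk _ h4⟩
    · obtain ⟨us', h3, h4⟩ := ih h2 fun s hs => H s (by simp [hs])
      exact ⟨u ::ₘ us', by simpa using Mon3.cons h1 h3, h4.cons u⟩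

/-- Reducing the argument of a substitution. -/
theorem QSub.exists_step_arg {x s t t' ts h} (ht : Step t t') (hs : QSub x s (t' ::ₘ ts) h) :
    ∃ f, QSub x s (t ::ₘ ts) f ∧ Step f h := by
  induction s using ResTerm.induct generalizing x t t' ts h with
  | var n =>
    rcases hs.var_inv with ⟨rfl, e⟩ | ⟨hn, e, -⟩
    · obtain ⟨rfl, rfl⟩ := (Multiset.cons_eq_cons.1 (e.trans (Multiset.cons_zero _).symm)).elim id
        (by simp)
      exact ⟨t, .hit _ _, ht⟩
    · simp at e
  | lam s ih =>
    obtain ⟨v, rfl, h1⟩ := hs.lam_inv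
    rw [Multiset.map_cons] at h1
    obtain ⟨f, h2, h3⟩ := ih (ht.shift 0) h1
    exact ⟨qLam f, .lam (by rwa [Multiset.map_cons]), h3.lam⟩
  | inj c s ih =>
    obtain ⟨v, rfl, h1⟩ := hs.inj_inv
    obtain ⟨f, h2, h3⟩ := ih ht h1
    exact ⟨_, .inj c h2, .inj c h3⟩
  | app s m ihs ihm =>
    obtain ⟨t₁, t₂, v, w, e, rfl, h1, h2⟩ := hs.app_inv
    rcases Multiset.cons_eq_add e with ⟨r, rfl, rfl⟩ | ⟨r, rfl, rfl⟩
    · obtain ⟨f, h3, h4⟩ := ihs ht h1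
      exact ⟨_, by simpa using h3.app h2, .appL _ h4⟩
    · obtain ⟨us, h3, h4⟩ := h2.exists_stepM fun s hs _ _ h => ihm s hs ht h
      exact ⟨_, by simpa using h1.app h3, .app _ h4⟩

/-- Reducing the term in which one substitutes. -/
theorem QSub.exists_step {x s s' t h} (hs : Step s s') (h₁ : QSub x s' t h) :
    ∃ f, QSub x s t f ∧ Step f h := by
  induction hs generalizing x t h with
  | beta hb =>
    obtain ⟨t₁, t₂, p₁, q₁, rfl, h1, h2, h3⟩ := hb.comp (Nat.zero_le x) h₁
    exact ⟨_, h1.lam.app h2, .beta h3⟩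
  | appInj c s m =>
    obtain ⟨v, rfl, h2⟩ := h₁.inj_inv
    obtain ⟨t₁, t₂, v, w, rfl, rfl, h3, h4⟩ := h2.app_inv
    exact ⟨_, (h3.inj c).app h4, .appInj _ _ _⟩
  | lamInj c s =>
    obtain ⟨v, rfl, h2⟩ := h₁.inj_inv
    obtain ⟨v, rfl, h3⟩ := h2.lam_inv
    exact ⟨_, (h3.inj c).lam, .lamInj _ _⟩
  | lam _ ih =>
    obtain ⟨v, rfl, h2⟩ := h₁.lam_inv
    obtain ⟨f, h3, h4⟩ := ih h2
    exact ⟨_, h3.lam, h4.lam⟩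
  | inj c _ ih =>
    obtain ⟨v, rfl, h2⟩ := h₁.inj_inv
    obtain ⟨f, h3, h4⟩ := ih h2
    exact ⟨_, h3.inj c, h4.inj c⟩
  | appL m _ ih =>
    obtain ⟨t₁, t₂, v, w, rfl, rfl, h2, h3⟩ := h₁.app_inv
    obtain ⟨f, h4, h5⟩ := ih h2
    exact ⟨_, h4.app h3, h5.appL _⟩
  | appR s m _ ih =>
    obtain ⟨t₁, t₂, v, w, rfl, rfl, h2, h3⟩ := h₁.app_inv
    obtain ⟨t₂, t₃, u, w, rfl, rfl, h4, h5⟩ := h3.cons_inv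
    obtain ⟨f, h6, h7⟩ := ih h4
    exact ⟨_, h2.app (.cons h6 h5), h7.appR _ _⟩

/-! ### Coherence on resource terms -/

/-- Coherence of resource terms, in symmetric form. -/
inductive Coh : ResTerm → ResTerm → Prop
  | var (n : ℕ) : Coh (qVar n) (qVar n)
  | lam {s s'} : Coh s s' → Coh (qLam s) (qLam s')
  | inj (c : Bool) {s s'} : Coh s s' → Coh (qInj c s) (qInj c s')
  | mix {c d : Bool} (s s') : c ≠ d → Coh (qInj c s) (qInj d s')
  | app {s s' t t'} : Coh s s' → (∀ b ∈ t + t', ∀ b' ∈ t + t', Coh b b') →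
      Coh (qApp s t) (qApp s' t')

namespace Coh

theorem var_inv {n s'} (h : Coh (qVar n) s') : s' = qVar n := by
  generalize hs : qVar n = s at h
  cases h <;> simp_all

theorem lam_inv {s s'} (h : Coh (qLam s) s') : ∃ r, s' = qLam r ∧ Coh s r := by
  generalize hs : qLam s = r at h
  cases h <;> simp_all

theorem inj_inv {c s s'} (h : Coh (qInj c s) s') :
    ∃ d r, s' = qInj d r ∧ (c = d → Coh s r) := by
  generalize hs : qInj c s = r at h
  cases h with
  | inj c h => simp_all
  | mix s s' h => simp_all
  | _ => simp at hs

theorem app_inv {s t s'} (h : Coh (qApp s t) s') :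
    ∃ r t', s' = qApp r t' ∧ Coh s r ∧ ∀ b ∈ t + t', ∀ b' ∈ t + t', Coh b b' := by
  generalize hs : qApp s t = r at h
  cases h with
  | app h h' =>
    obtain ⟨rfl, rfl⟩ := qApp_inj.1 hs
    exact ⟨_, _, rfl, h, h'⟩
  | _ => simp at hs

theorem inj_of {c d s s'} (h : c = d → Coh s s') : Coh (qInj c s) (qInj d s') := by
  by_cases e : c = d
  · subst e; exact .inj c (h rfl)
  · exact .mix _ _ e

theorem shift {s s' : ResTerm} (h : Coh s s') (c : ℕ) : Coh (qShift c s) (qShift c s') := by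
  induction h generalizing c with
  | var => simpa using .var _
  | lam _ ih => simpa using .lam (ih _)
  | inj d _ ih => simpa using .inj d (ih _)
  | mix s s' h => simpa using .mix _ _ h
  | app _ _ ih ih' =>
    rw [qShift_qApp, qShift_qApp]
    refine .app (ih _) ?_
    rw [← Multiset.map_add]
    simp only [Multiset.forall_mem_map_iff]
    exact fun b hb b' hb' => ih' b hb b' hb' c

end Coh

theorem qWeight_lt_of_mem {s : ResTerm} {t : Multiset ResTerm} (h : s ∈ t) (k : ℕ) :
    qWeight k s ≤ mWeight k t := by
  obtain ⟨t, rfl⟩ := Multiset.exists_cons_of_mem h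
  simp

/-- Two multisets whose elements are determined by a common image are equal. -/
theorem Multiset.eq_of_map_eq {α β : Type*} {f : α → β} {s t : Multiset α}
    (h : s.map f = t.map f) (H : ∀ a ∈ s, ∀ b ∈ t, f a = f b → a = b) : s = t := by
  have h1 := Multiset.rel_map.1 (Multiset.rel_eq.2 h)
  exact Multiset.rel_eq.1 (h1.mono H)

/-- Substitution into coherent terms of coherent arguments yields coherent
terms, and is injective. -/
theorem QSub.coh_aux (n : ℕ) : ∀ {x s s' t t' u u'}, qWeight 1 s < n → qWeight 1 s' < n →
    QSub x s t u → QSub x s' t' u' → Coh s s' → (∀ b ∈ t + t', ∀ b' ∈ t + t', Coh b b') →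
    Coh u u' ∧ (u = u' → s = s' ∧ t = t') := by
  induction n with
  | zero => intro x s s' t t' u u' h; omega
  | succ n IH =>
  intro x s s' t t' u u' hn hn' h h' hc hcm
  cases s using ResTerm.induct with
  | var k =>
    obtain rfl := hc.var_inv
    rcases h.var_inv with ⟨rfl, rfl⟩ | ⟨hk, rfl, rfl⟩
    · rcases h'.var_inv with ⟨_, rfl⟩ | ⟨hk', rfl, rfl⟩
      · exact ⟨hcm _ (by simp) _ (by simp), by rintro rfl; simp⟩
      · exact absurd rfl hk'
    · rcases h'.var_inv with ⟨hk', rfl⟩ | ⟨hk', rfl, rfl⟩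
      · exact absurd hk' hk
      · exact ⟨.var _, by simp⟩
  | lam s _ =>
    obtain ⟨s', rfl, hc'⟩ := hc.lam_inv
    obtain ⟨u, rfl, h1⟩ := h.lam_inv
    obtain ⟨u', rfl, h2⟩ := h'.lam_inv
    simp only [qWeight_qLam] at hn hn'
    obtain ⟨h3, h4⟩ := IH (by omega) (by omega) h1 h2 hc' (by
      rw [← Multiset.map_add]
      simp only [Multiset.forall_mem_map_iff]
      exact fun b hb b' hb' => (hcm b hb b' hb').shift 0)
    refine ⟨h3.lam, fun e => ?_⟩
    obtain ⟨rfl, h5⟩ := h4 (qLam_inj.1 e)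
    exact ⟨rfl, Multiset.map_injective (qShift_injective 0) h5⟩
  | inj c s _ =>
    obtain ⟨d, s', rfl, hc'⟩ := hc.inj_inv
    obtain ⟨u, rfl, h1⟩ := h.inj_inv
    obtain ⟨u', rfl, h2⟩ := h'.inj_inv
    simp only [qWeight_qInj] at hn hn'
    refine ⟨.inj_of fun e => (IH (by omega) (by omega) h1 h2 (hc' e) hcm).1, fun e => ?_⟩
    obtain ⟨rfl, rfl⟩ := qInj_inj.1 e
    obtain ⟨rfl, rfl⟩ := (IH (by omega) (by omega) h1 h2 (hc' rfl) hcm).2 rfl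
    exact ⟨rfl, rfl⟩
  | app s m _ _ =>
    obtain ⟨s', m', rfl, hc1, hc2⟩ := hc.app_inv
    obtain ⟨t₁, t₂, u, w, rfl, rfl, h1, h2⟩ := h.app_inv
    obtain ⟨t₁', t₂', u', w', rfl, rfl, h1', h2'⟩ := h'.app_inv
    simp only [qWeight_qApp] at hn hn'
    obtain ⟨h3, h4⟩ := IH (by omega) (by omega) h1 h1' hc1 fun b hb b' hb' =>
      hcm b (by simp at hb ⊢; tauto) b' (by simp at hb' ⊢; tauto)
    obtain ⟨L, hL, rfl, rfl, rfl⟩ := h2.exists_list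
    obtain ⟨L', hL', rfl, rfl, rfl⟩ := h2'.exists_list
    have key : ∀ p ∈ L + L', ∀ q ∈ L + L',
        Coh p.2.2 q.2.2 ∧ (p.2.2 = q.2.2 → p.1 = q.1 ∧ p.2.1 = q.2.1) := by
      have hsub : ∀ p ∈ L + L', QSub x p.1 p.2.1 p.2.2 := fun p hp =>
        (Multiset.mem_add.1 hp).elim (hL p) (hL' p)
      have hw : ∀ p ∈ L + L', qWeight 1 p.1 < n := fun p hp => by
        rcases Multiset.mem_add.1 hp with hp | hp
        · have := qWeight_lt_of_mem (Multiset.mem_map_of_mem (·.1) hp) 1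
          omega
        · have := qWeight_lt_of_mem (Multiset.mem_map_of_mem (·.1) hp) 1
          omega
      have hm : ∀ p ∈ L + L', p.1 ∈ L.map (·.1) + L'.map (·.1) := fun p hp => by
        rw [← Multiset.map_add]
        exact Multiset.mem_map_of_mem _ hp
      have hs : ∀ p ∈ L + L', ∀ b ∈ p.2.1,
          b ∈ t₁ + (L.map (·.2.1)).sum + (t₁' + (L'.map (·.2.1)).sum) := fun p hp b hb => by
        have h5 : b ∈ ((L + L').map (·.2.1)).join :=
          Multiset.mem_join.2 ⟨_, Multiset.mem_map_of_mem _ hp, hb⟩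
        rw [Multiset.map_add, Multiset.join_add] at h5
        simp only [Multiset.mem_add] at h5 ⊢
        exact h5.elim (fun h => .inl (.inr h)) (fun h => .inr (.inr h))
      intro p hp q hq
      refine IH (hw p hp) (hw q hq) (hsub p hp) (hsub q hq) (hc2 _ (hm p hp) _ (hm q hq)) ?_
      intro b hb b' hb'
      exact hcm b ((Multiset.mem_add.1 hb).elim (hs p hp b) (hs q hq b)) b'
        ((Multiset.mem_add.1 hb').elim (hs p hp b') (hs q hq b'))
    constructor
    · refine .app h3 ?_
      rw [← Multiset.map_add]
      intro b hb b' hb'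
      obtain ⟨p, hp, rfl⟩ := Multiset.mem_map.1 hb
      obtain ⟨q, hq, rfl⟩ := Multiset.mem_map.1 hb'
      exact (key p hp q hq).1
    · intro e
      obtain ⟨rfl, e'⟩ := qApp_inj.1 e
      obtain ⟨rfl, rfl⟩ := h4 rfl
      obtain rfl := Multiset.eq_of_map_eq e' fun p hp q hq e => by
        obtain ⟨h5, h6⟩ := (key p (by simp [hp]) q (by simp [hq])).2 e
        exact Prod.ext h5 (Prod.ext h6 e)
      exact ⟨rfl, rfl⟩

theorem QSub.coh {x s s' t t' u u'} (h : QSub x s t u) (h' : QSub x s' t' u') (hc : Coh s s')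
    (hcm : ∀ b ∈ t + t', ∀ b' ∈ t + t', Coh b b') :
    Coh u u' ∧ (u = u' → s = s' ∧ t = t') :=
  QSub.coh_aux (qWeight 1 s + qWeight 1 s' + 1) (by omega) (by omega) h h' hc hcm

/-! ### Normal terms, spines -/

/-- The resource terms to which a reduction rule applies. -/
inductive Redex : ResTerm → Prop
  | beta (s t) : Redex (qApp (qLam s) t)
  | appInj (c s t) : Redex (qApp (qInj c s) t)
  | lamInj (c s) : Redex (qLam (qInj c s))
  | lam {s} : Redex s → Redex (qLam s)
  | inj (c) {s} : Redex s → Redex (qInj c s)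
  | appL (t) {s} : Redex s → Redex (qApp s t)
  | appR (s t) {p} : Redex p → Redex (qApp s (p ::ₘ t))

theorem Redex.app (s : ResTerm) {t : Multiset ResTerm} {p : ResTerm} (hp : p ∈ t) (h : Redex p) :
    Redex (qApp s t) := by
  obtain ⟨t, rfl⟩ := Multiset.exists_cons_of_mem hp
  exact .appR s t h

/-- Reduction to a summand, in any number of steps. -/
abbrev Steps : ResTerm → ResTerm → Prop := Relation.ReflTransGen Step

theorem Steps.inj (c : Bool) {s s' : ResTerm} (h : Steps s s') : Steps (qInj c s) (qInj c s') :=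
  Relation.ReflTransGen.lift (qInj c) (fun _ _ h => Step.inj c h) _ _ h

/-- Iterated application of a term to monomials. -/
noncomputable def spine (s : ResTerm) (K : List (Multiset ResTerm)) : ResTerm := K.foldl qApp s

@[simp] theorem spine_nil (s : ResTerm) : spine s [] = s := rfl

@[simp] theorem spine_cons (s : ResTerm) (t : Multiset ResTerm) (K : List (Multiset ResTerm)) :
    spine s (t :: K) = spine (qApp s t) K := rfl

@[elab_as_elim]
theorem ResTerm.spine_cases {P : ResTerm → Prop} (var : ∀ n K, P (spine (qVar n) K))
    (lam : ∀ s K, P (spine (qLam s) K)) (inj : ∀ c s K, P (spine (qInj c s) K)) (s : ResTerm) :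
    P s := by
  suffices H : ∀ K, P (spine s K) from H []
  induction s using ResTerm.induct with
  | var n => exact var n
  | lam s _ => exact lam s
  | inj c s _ => exact inj c s
  | app s t ih _ => exact fun K => ih (t :: K)

theorem spine_inj {s s' : ResTerm} {K K' : List (Multiset ResTerm)} (hK : K.length = K'.length)
    (h : spine s K = spine s' K') : s = s' ∧ K = K' := by
  induction K generalizing s s' K' with
  | nil =>
    obtain rfl := List.length_eq_zero_iff.1 hK.symm
    exact ⟨h, rfl⟩
  | cons t K ih =>
    cases K' with
    | nil => simp at hK
    | cons t' K' =>
      obtain ⟨h1, rfl⟩ := ih (s := qApp s t) (s' := qApp s' t') (by simpa using hK) h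
      obtain ⟨rfl, rfl⟩ := qApp_inj.1 h1
      exact ⟨rfl, rfl⟩

theorem spine_weight_lt {s s' : ResTerm} (h : qWeight 1 s < qWeight 1 s')
    (K : List (Multiset ResTerm)) : qWeight 1 (spine s K) < qWeight 1 (spine s' K) := by
  induction K generalizing s s' with
  | nil => exact h
  | cons t K ih => exact ih (by simpa using h)

theorem weight_le_spine (s : ResTerm) (K : List (Multiset ResTerm)) :
    qWeight 1 s ≤ qWeight 1 (spine s K) := by
  induction K generalizing s with
  | nil => exact le_rfl
  | cons t K ih => exact le_trans (by simp; omega) (ih _)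

theorem weight_lt_spine {s : ResTerm} {K : List (Multiset ResTerm)} {t : Multiset ResTerm}
    (ht : t ∈ K) : mWeight 1 t < qWeight 1 (spine s K) := by
  induction K generalizing s with
  | nil => simp at ht
  | cons t' K ih =>
    rcases List.mem_cons.1 ht with rfl | ht
    · exact lt_of_lt_of_le (by simp) (weight_le_spine (qApp s t) K)
    · exact ih ht

theorem Redex.spine {s : ResTerm} (h : Redex s) (K : List (Multiset ResTerm)) :
    Redex (spine s K) := by
  induction K generalizing s with
  | nil => exact h
  | cons t K ih => exact ih (h.appL t)

theorem Redex.spine_arg {s p : ResTerm} {K : List (Multiset ResTerm)} {t : Multiset ResTerm}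
    (ht : t ∈ K) (hp : p ∈ t) (h : Redex p) : Redex (_root_.spine s K) := by
  induction K generalizing s with
  | nil => simp at ht
  | cons t' K ih =>
    rcases List.mem_cons.1 ht with rfl | ht
    · exact (Redex.app s hp h).spine K
    · exact ih ht

/-- Reduction of one element of one argument. -/
inductive StepK : List (Multiset ResTerm) → List (Multiset ResTerm) → Prop
  | head (K) {t t'} : StepM t t' → StepK (t :: K) (t' :: K)
  | tail (t) {K K'} : StepK K K' → StepK (t :: K) (t :: K')

theorem Step.spine {s s' : ResTerm} (h : Step s s') (K : List (Multiset ResTerm)) :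
    Step (spine s K) (spine s' K) := by
  induction K generalizing s s' with
  | nil => exact h
  | cons t K ih => exact ih (h.appL t)

theorem StepK.spine {K K' : List (Multiset ResTerm)} (h : StepK K K') (s : ResTerm) :
    Step (spine s K) (spine s K') := by
  induction h generalizing s with
  | head K h => exact (Step.app s h).spine K
  | tail t _ ih => exact ih _

/-- The contraction of an application whose head is an abstraction or a sum. -/
inductive Contract : ResTerm → Multiset ResTerm → ResTerm → Prop
  | beta {s t u} : QSub 0 s t u → Contract (qLam s) t u
  | appInj (c s t) : Contract (qInj c s) t (qInj c (qApp s t))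

namespace Step

theorem not_var {n f} : ¬ Step (qVar n) f := by
  intro h
  generalize hs : qVar n = s at h
  cases h <;> simp at hs

theorem inj_inv {c s f} (h : Step (qInj c s) f) : ∃ s', f = qInj c s' ∧ Step s s' := by
  generalize hs : qInj c s = r at h
  cases h <;> simp_all

theorem lam_inv {s f} (h : Step (qLam s) f) :
    (∃ s', f = qLam s' ∧ Step s s') ∨ ∃ c r, s = qInj c r ∧ f = qInj c (qLam r) := by
  generalize hs : qLam s = r at h
  cases h <;> simp_all

theorem app_inv {s t f} (h : Step (qApp s t) f) :
    (∃ s', f = qApp s' t ∧ Step s s') ∨ (∃ t', f = qApp s t' ∧ StepM t t') ∨ Contract s t f := by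
  generalize hs : qApp s t = r at h
  cases h with
  | beta h => obtain ⟨rfl, rfl⟩ := qApp_inj.1 hs; exact .inr (.inr (.beta h))
  | appInj => obtain ⟨rfl, rfl⟩ := qApp_inj.1 hs; exact .inr (.inr (.appInj _ _ _))
  | appL t h => obtain ⟨rfl, rfl⟩ := qApp_inj.1 hs; exact .inl ⟨_, rfl, h⟩
  | appR s t h => obtain ⟨rfl, rfl⟩ := qApp_inj.1 hs; exact .inr (.inl ⟨_, rfl, .mk _ h⟩)
  | _ => simp at hs

theorem spine_inv {s K f} (h : Step (_root_.spine s K) f) :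
    (∃ s', f = _root_.spine s' K ∧ Step s s') ∨ (∃ K', f = _root_.spine s K' ∧ StepK K K') ∨
      ∃ t K' u, K = t :: K' ∧ f = _root_.spine u K' ∧ Contract s t u := by
  induction K generalizing s with
  | nil => exact .inl ⟨f, rfl, h⟩
  | cons t K ih =>
    rcases ih h with ⟨r, rfl, h1⟩ | ⟨K', rfl, h1⟩ | ⟨t', K', u, rfl, rfl, h1⟩
    · rcases h1.app_inv with ⟨s', rfl, h2⟩ | ⟨t', rfl, h2⟩ | h2
      · exact .inl ⟨s', rfl, h2⟩
      · exact .inr (.inl ⟨t' :: K, rfl, .head K h2⟩)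
      · exact .inr (.inr ⟨t, K, r, rfl, rfl, h2⟩)
    · exact .inr (.inl ⟨t :: K', rfl, .tail t h1⟩)
    · generalize hs : qApp s t = r at h1
      cases h1 <;> simp at hs

end Step

namespace Steps

theorem spine_inj_normal {c s K b} (h : Steps (spine (qInj c s) K) b) (hb : ¬ Redex b) :
    ∃ b', b = qInj c b' ∧ Steps (spine s K) b' := by
  generalize he : spine (qInj c s) K = e at h
  induction h using Relation.ReflTransGen.head_induction_on generalizing s K with
  | refl =>
    subst he
    cases K with
    | nil => exact ⟨s, rfl, .refl⟩
    | cons t K => exact absurd ((Redex.appInj c s t).spine K) hb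
  | head h _ ih =>
    subst he
    rcases h.spine_inv with ⟨r, rfl, h1⟩ | ⟨K', rfl, h1⟩ | ⟨t, K', u, rfl, rfl, h1⟩
    · obtain ⟨s', rfl, h2⟩ := h1.inj_inv
      obtain ⟨b', rfl, h3⟩ := ih rfl
      exact ⟨b', rfl, .head (h2.spine K) h3⟩
    · obtain ⟨b', rfl, h3⟩ := ih rfl
      exact ⟨b', rfl, .head (h1.spine s) h3⟩
    · generalize hr : qInj c s = r at h1
      cases h1 with
      | beta => simp at hr
      | appInj =>
        obtain ⟨rfl, rfl⟩ := qInj_inj.1 hr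
        exact ih (s := qApp s t) (K := K') rfl

theorem spine_inj_comm (c : Bool) (s : ResTerm) (K : List (Multiset ResTerm)) :
    Steps (spine (qInj c s) K) (qInj c (spine s K)) := by
  induction K generalizing s with
  | nil => exact .refl
  | cons t K ih => exact .head ((Step.appInj c s t).spine K) (ih _)

theorem spine_var {x K b} (h : Steps (spine (qVar x) K) b) :
    ∃ K₁, b = spine (qVar x) K₁ ∧ List.Forall₂ (Multiset.Rel Steps) K K₁ := by
  generalize he : spine (qVar x) K = e at h
  induction h using Relation.ReflTransGen.head_induction_on generalizing K with
  | refl =>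
    exact ⟨K, he.symm, List.forall₂_same.2 fun _ _ => Multiset.rel_refl_of_refl_on fun _ _ => .refl⟩
  | head h _ ih =>
    subst he
    rcases h.spine_inv with ⟨r, rfl, h1⟩ | ⟨K', rfl, h1⟩ | ⟨t, K', u, rfl, rfl, h1⟩
    · exact absurd h1 Step.not_var
    · obtain ⟨K₁, rfl, h2⟩ := ih rfl
      refine ⟨K₁, rfl, ?_⟩
      clear h ih
      rename_i h
      clear h
      induction h1 generalizing K₁ with
      | head K h =>
        obtain ⟨t, h⟩ := h
        cases h2 with
        | cons h3 h4 =>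
          obtain ⟨p, t₁, h5, h6, rfl⟩ := Multiset.rel_cons_left.1 h3
          exact .cons (.cons (.head h h5) h6) h4
      | tail t _ ih =>
        cases h2 with
        | cons h3 h4 => exact .cons h3 (ih _ h4)
    · generalize hr : qVar x = r at h1
      cases h1 <;> simp at hr

theorem spine_lam (e : ResTerm) : ∀ {s t K b}, spine (qLam s) (t :: K) = e → Steps e b →
    ¬ Redex b → ∃ u, QSub 0 s t u ∧ Steps (spine u K) b := by
  induction e using Smaller.wf.induction with
  | h e IH =>
  intro s t K b he h hb
  subst he
  rcases h.cases_head with rfl | ⟨f, h1, h2⟩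
  · exact absurd ((Redex.beta s t).spine K) hb
  rcases h1.spine_inv with ⟨r, rfl, h3⟩ | ⟨K', rfl, h3⟩ | ⟨t, K', u, e, rfl, h3⟩
  · rcases h3.lam_inv with ⟨s', rfl, h4⟩ | ⟨c, p, rfl, rfl⟩
    · obtain ⟨u, h5, h6⟩ := IH _ h1.smaller rfl h2 hb
      obtain ⟨f, h7, h8⟩ := h5.exists_step h4
      exact ⟨f, h7, .head (h8.spine K) h6⟩
    · obtain ⟨b', rfl, h5⟩ := spine_inj_normal h2 hb
      obtain ⟨u, h6, h7⟩ := IH _ (.inl (spine_weight_lt (by simp) (t :: K))) rfl h5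
        fun h => hb (h.inj c)
      exact ⟨_, h6.inj c, (spine_inj_comm c u K).trans (h7.inj c)⟩
  · cases h3 with
    | head K h9 =>
      obtain ⟨u, h5, h6⟩ := IH _ h1.smaller rfl h2 hb
      obtain ⟨t, h9⟩ := h9
      obtain ⟨f, h7, h8⟩ := h5.exists_step_arg h9
      exact ⟨f, h7, .head (h8.spine K) h6⟩
    | tail t h =>
      obtain ⟨u, h5, h6⟩ := IH _ h1.smaller rfl h2 hb
      exact ⟨u, h5, .head (h.spine u) h6⟩
  · obtain ⟨rfl, rfl⟩ := List.cons_eq_cons.1 e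
    generalize hr : qLam s = r at h3
    cases h3 with
    | beta h => obtain rfl := qLam_inj.1 hr; exact ⟨u, h, h2⟩
    | appInj => simp at hr

end Steps

/-- `Push b a` holds when `a` is `λ.b` with the abstraction pushed under some sums. -/
inductive Push : ResTerm → ResTerm → Prop
  | lam (b) : Push b (qLam b)
  | inj (c) {b a} : Push b a → Push (qInj c b) (qInj c a)

theorem Push.unique {b b' a} (h : Push b a) (h' : Push b' a) : b = b' := by
  induction h generalizing b' with
  | lam b =>
    generalize hr : qLam b = r at h'
    cases h' <;> simp_all
  | inj c h ih =>
    rename_i b a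
    generalize hr : qInj c a = r at h'
    cases h' with
    | lam => simp at hr
    | inj d h' => obtain ⟨rfl, rfl⟩ := qInj_inj.1 hr; rw [ih h']

theorem Push.redex {b a} (h : Push b a) (hb : Redex b) : Redex a := by
  induction h with
  | lam => exact hb.lam
  | inj c h ih =>
    rename_i b a
    refine .inj c (ih ?_)
    generalize hr : qInj c b = r at hb
    cases hb <;> simp_all

theorem Push.step {b a a'} (h : Push b a) (ha : Step a a') : ∃ b', Steps b b' ∧ Push b' a' := by
  induction h generalizing a' with
  | lam b =>
    rcases ha.lam_inv with ⟨s', rfl, h4⟩ | ⟨c, p, rfl, rfl⟩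
    · exact ⟨s', .single h4, .lam _⟩
    · exact ⟨_, .refl, .inj c (.lam p)⟩
  | inj c h ih =>
    obtain ⟨a', rfl, h1⟩ := ha.inj_inv
    obtain ⟨b', h2, h3⟩ := ih h1
    exact ⟨_, h2.inj c, .inj c h3⟩

theorem Steps.exists_push {s a} (h : Steps (qLam s) a) : ∃ b, Steps s b ∧ Push b a := by
  induction h with
  | refl => exact ⟨s, .refl, .lam s⟩
  | tail _ h ih =>
    obtain ⟨b, h1, h2⟩ := ih
    obtain ⟨b', h3, h4⟩ := h2.step h
    exact ⟨b', h1.trans h3, h4⟩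

theorem Coh.spine_inv {h K e'} (hc : Coh (spine h K) e') : ∃ h' K', e' = spine h' K' ∧ Coh h h' ∧
    List.Forall₂ (fun t t' => ∀ b ∈ t + t', ∀ b' ∈ t + t', Coh b b') K K' := by
  induction K generalizing h with
  | nil => exact ⟨e', [], rfl, hc, .nil⟩
  | cons t K ih =>
    obtain ⟨h₁, K', rfl, h2, h3⟩ := ih hc
    obtain ⟨h', t', rfl, h4, h5⟩ := h2.app_inv
    exact ⟨h', t' :: K', rfl, h4, .cons h5 h3⟩

theorem Coh.spine_congr {h h' K K'} (hc : Coh h h')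
    (hK : List.Forall₂ (fun t t' => ∀ b ∈ t + t', ∀ b' ∈ t + t', Coh b b') K K') :
    Coh (spine h K) (spine h' K') := by
  induction hK generalizing h h' with
  | nil => exact hc
  | cons h1 _ ih => exact ih (Coh.app hc h1)

theorem Multiset.eq_of_rel {α β : Type*} {R : α → β → Prop} {s t : Multiset α} {u : Multiset β}
    (hs : s.Rel R u) (ht : t.Rel R u)
    (H : ∀ a ∈ s, ∀ b ∈ t, ∀ c ∈ u, R a c → R b c → a = b) : s = t := by
  induction u using Multiset.induction generalizing s t with
  | empty => rw [Multiset.rel_zero_right.1 hs, Multiset.rel_zero_right.1 ht]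
  | cons c u ih =>
    obtain ⟨a, s, h1, h2, rfl⟩ := Multiset.rel_cons_right.1 hs
    obtain ⟨b, t, h3, h4, rfl⟩ := Multiset.rel_cons_right.1 ht
    rw [H a (by simp) b (by simp) c (by simp) h1 h3, ih h2 h4 fun a ha b hb c hc =>
      H a (by simp [ha]) b (by simp [hb]) c (by simp [hc])]

/-- Coherent terms with a common normal reduct are equal. -/
theorem Coh.eq_of_steps {e e' a : ResTerm} (hc : Coh e e') (h : Steps e a) (h' : Steps e' a)
    (ha : ¬ Redex a) : e = e' := by
  induction e using Smaller.wf.induction generalizing e' a with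
  | h e IH =>
  cases e using ResTerm.spine_cases with
  | var x K =>
    obtain ⟨r, K', rfl, hr, hK⟩ := hc.spine_inv
    obtain rfl := hr.var_inv
    obtain ⟨K₁, rfl, h1⟩ := h.spine_var
    obtain ⟨K₂, e, h2⟩ := h'.spine_var
    have hl := hK.length_eq
    obtain ⟨-, rfl⟩ := spine_inj (by rw [← h1.length_eq, ← h2.length_eq, hl]) e
    suffices K = K' by rw [this]
    refine List.ext_get hl fun i hi hi' => ?_
    have hi₁ : i < K₁.length := h1.length_eq ▸ hi
    refine Multiset.eq_of_rel (h1.get hi hi₁) (h2.get hi' hi₁) fun p hp q hq c hcm hpc hqc => ?_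
    refine IH p (.inl ?_) ?_ hpc hqc fun hr => ha (hr.spine_arg (List.get_mem K₁ ⟨i, hi₁⟩) hcm)
    · exact lt_of_le_of_lt (qWeight_lt_of_mem hp 1) (weight_lt_spine (List.get_mem K _))
    · exact hK.get hi hi' p (Multiset.mem_add.2 (.inl hp)) q (Multiset.mem_add.2 (.inr hq))
  | inj c s K =>
    obtain ⟨r, K', rfl, hr, hK⟩ := hc.spine_inv
    obtain ⟨d, s', rfl, hr'⟩ := hr.inj_inv
    obtain ⟨b, rfl, h1⟩ := h.spine_inj_normal ha
    obtain ⟨b', e, h2⟩ := h'.spine_inj_normal ha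
    obtain ⟨rfl, rfl⟩ := qInj_inj.1 e
    have h3 := IH (spine s K) (.inl (spine_weight_lt (by simp) K)) ((hr' rfl).spine_congr hK) h1 h2
      fun hb => ha (hb.inj c)
    obtain ⟨rfl, rfl⟩ := spine_inj hK.length_eq h3
    rfl
  | lam s K =>
    obtain ⟨r, K', rfl, hr, hK⟩ := hc.spine_inv
    obtain ⟨s', rfl, hr'⟩ := hr.lam_inv
    cases hK with
    | nil =>
      obtain ⟨b, h1, h2⟩ := Steps.exists_push h
      obtain ⟨b', h3, h4⟩ := Steps.exists_push h'
      obtain rfl := h2.unique h4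
      rw [IH s (.inl (by simp)) hr' h1 h3 fun hb => ha (h2.redex hb)]
    | cons ht hK =>
      obtain ⟨u, h1, h2⟩ := Steps.spine_lam _ rfl h ha
      obtain ⟨u', h3, h4⟩ := Steps.spine_lam _ rfl h' ha
      obtain ⟨h5, h6⟩ := h1.coh h3 hr' ht
      have h7 := IH _ ((Step.beta h1).spine _).smaller (h5.spine_congr hK) h2 h4 ha
      obtain ⟨rfl, rfl⟩ := spine_inj hK.length_eq h7
      obtain ⟨rfl, rfl⟩ := h6 rfl
      rfl

/-! ### Rigid substitution and reduction of sums -/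

theorem toMul_take_add_drop (n : ℕ) (bs : List Rt) :
    toMul (bs.take n) + toMul (bs.drop n) = toMul bs := by
  simp [toMul, -List.map_append]

theorem rsubstL_mon3 {x : ℕ} {ds bs us : List Rt}
    (H : ∀ d ∈ ds, ∀ bs u, rsubst d x bs = some u → QSub x (rmk d) (toMul bs) (rmk u))
    (h : rsubstL ds x bs = some us) : Mon3 (QSub x) (toMul ds) (toMul bs) (toMul us) := by
  induction ds generalizing bs us with
  | nil =>
    cases bs with
    | nil =>
      simp only [rsubstL, Option.some.injEq] at h
      subst h
      exact .nil
    | cons b bs => simp [rsubstL] at h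
  | cons d ds ih =>
    rw [rsubstL] at h
    split at h
    · rename_i a' as' h1 h2
      obtain rfl := Option.some.inj h
      rw [← toMul_take_add_drop (nx x d) bs]
      exact .cons (H d (by simp) _ _ h1) (ih (fun d hd => H d (by simp [hd])) h2)
    · simp at h

theorem rsubst_qSub {a : Rt} {x : ℕ} {bs : List Rt} {u : Rt} (h : rsubst a x bs = some u) :
    QSub x (rmk a) (toMul bs) (rmk u) := by
  induction a using Rt.induct generalizing x bs u with
  | var n =>
    by_cases hn : n = x
    · rcases bs with _ | ⟨b, _ | ⟨b', bs⟩⟩ <;> simp [rsubst, hn] at h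
      subst h hn
      exact .hit _ _
    · rcases bs with _ | ⟨b, _ | ⟨b', bs⟩⟩ <;> simp [rsubst, hn] at h
      subst h
      exact .miss x n hn
  | lam a ih =>
    rw [rsubst, Option.map_eq_some_iff] at h
    obtain ⟨u, h, rfl⟩ := h
    rw [rmk_lam, rmk_lam]
    refine .lam ?_
    rw [← toMul_map_shiftR]
    exact ih h
  | inl a ih =>
    rw [rsubst, Option.map_eq_some_iff] at h
    obtain ⟨u, h, rfl⟩ := h
    rw [rmk_inl, rmk_inl]
    exact .inj _ (ih h)
  | inr a ih =>
    rw [rsubst, Option.map_eq_some_iff] at h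
    obtain ⟨u, h, rfl⟩ := h
    rw [rmk_inr, rmk_inr]
    exact .inj _ (ih h)
  | app c ds ihc ihd =>
    rw [rsubst] at h
    split at h
    · rename_i c' ds' h1 h2
      obtain rfl := Option.some.inj h
      rw [rmk_app, rmk_app, ← toMul_take_add_drop (nx x c) bs]
      exact .app (ihc h1) (rsubstL_mon3 (fun d hd _ _ h => ihd d hd h) h2)
    · simp at h

theorem permList_perm {α : Type*} {n : ℕ} (σ : Equiv.Perm (Fin n)) (l : List α) :
    (permList σ l).Perm l := by
  unfold permList
  split_ifs with h
  · subst h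
    refine (Equiv.Perm.ofFn_comp_perm σ.symm l.get).trans ?_
    rw [List.ofFn_get]
  · rfl

theorem exists_of_mem_support_dsub {x : ℕ} {s : ResTerm} {t : Multiset ResTerm} {f : ResExpr}
    (h : f ∈ (dsub x (.inl s) t).support) : ∃ u, f = .inl u ∧ QSub x s t u := by
  classical
  obtain ⟨σ, -, h⟩ := Finset.mem_biUnion.1 (Finsupp.support_finsetSum h)
  simp only [outE, Sum.map_inl, rsubstE] at h
  cases hr : rsubst (rout s) x (permList σ (t.toList.map rout)) with
  | none => simp [hr] at h
  | some u =>
    simp only [hr, Option.map_some, Option.elim_some] at h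
    obtain rfl := Finset.mem_singleton.1 (Finsupp.support_single_subset h)
    refine ⟨rmk u, rfl, ?_⟩
    have h1 := rsubst_qSub hr
    rwa [rmk_rout, show toMul (permList σ (t.toList.map rout)) = t from
      (Multiset.coe_eq_coe.2 ((permList_perm _ _).map rmk)).trans (toMul_map_rout t)] at h1

/-- Reduction of an expression to a summand of one of its one-step reducts. -/
abbrev EStep : ResExpr → ResExpr → Prop := Sum.LiftRel Step StepM

theorem exists_mem_support_of_mapDomain {S : ResExpr →₀ ℕ} {c : ResExpr → ResExpr} {f : ResExpr}
    (h : f ∈ (S.mapDomain c).support) : ∃ g ∈ S.support, c g = f := by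
  classical
  exact Finset.mem_image.1 (Finsupp.mapDomain_support h)

theorem Red.eStep {e : ResExpr} {E : ResExpr →₀ ℕ} (h : Red e E) {f : ResExpr}
    (hf : f ∈ E.support) : EStep e f := by
  induction h generalizing f with
  | beta s t =>
    obtain ⟨u, rfl, hu⟩ := exists_of_mem_support_dsub hf
    exact .inl (.beta hu)
  | appInl s t =>
    obtain rfl := Finset.mem_singleton.1 (Finsupp.support_single_subset hf)
    exact .inl (.appInj false s t)
  | appInr s t =>
    obtain rfl := Finset.mem_singleton.1 (Finsupp.support_single_subset hf)
    exact .inl (.appInj true s t)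
  | lamInl s =>
    obtain rfl := Finset.mem_singleton.1 (Finsupp.support_single_subset hf)
    exact .inl (.lamInj false s)
  | lamInr s =>
    obtain rfl := Finset.mem_singleton.1 (Finsupp.support_single_subset hf)
    exact .inl (.lamInj true s)
  | lamCtx _ ih =>
    obtain ⟨g, hg, rfl⟩ := exists_mem_support_of_mapDomain hf
    cases ih hg with | inl h => exact .inl h.lam
  | appLCtx t _ ih =>
    obtain ⟨g, hg, rfl⟩ := exists_mem_support_of_mapDomain hf
    cases ih hg with | inl h => exact .inl (h.appL t)
  | appRCtx s _ ih =>
    obtain ⟨g, hg, rfl⟩ := exists_mem_support_of_mapDomain hf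
    cases ih hg with | inr h => exact .inl (.app s h)
  | inlCtx _ ih =>
    obtain ⟨g, hg, rfl⟩ := exists_mem_support_of_mapDomain hf
    cases ih hg with | inl h => exact .inl (h.inj false)
  | inrCtx _ ih =>
    obtain ⟨g, hg, rfl⟩ := exists_mem_support_of_mapDomain hf
    cases ih hg with | inl h => exact .inl (h.inj true)
  | monCtx t _ ih =>
    obtain ⟨g, hg, rfl⟩ := exists_mem_support_of_mapDomain hf
    cases ih hg with | inl h => exact .inr (.mk t h)

theorem Redex.exists_red {s : ResTerm} (h : Redex s) : ∃ E, Red (.inl s) E := by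
  induction h with
  | beta s t => exact ⟨_, .beta s t⟩
  | appInj c s t =>
    cases c
    · exact ⟨_, .appInl s t⟩
    · exact ⟨_, .appInr s t⟩
  | lamInj c s =>
    cases c
    · exact ⟨_, .lamInl s⟩
    · exact ⟨_, .lamInr s⟩
  | lam _ ih =>
    obtain ⟨E, h⟩ := ih
    exact ⟨_, .lamCtx h⟩
  | inj c _ ih =>
    obtain ⟨E, h⟩ := ih
    cases c
    · exact ⟨_, .inlCtx h⟩
    · exact ⟨_, .inrCtx h⟩
  | appL t _ ih =>
    obtain ⟨E, h⟩ := ih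
    exact ⟨_, .appLCtx t h⟩
  | appR s t _ ih =>
    obtain ⟨E, h⟩ := ih
    exact ⟨_, .appRCtx s (.monCtx t h)⟩

theorem RedS.eSteps {e : ResExpr} {E : ResExpr →₀ ℕ}
    (h : Relation.ReflTransGen RedS (Finsupp.single e 1) E) {f : ResExpr} (hf : f ∈ E.support) :
    Relation.ReflTransGen EStep e f := by
  classical
  induction h generalizing f with
  | refl =>
    obtain rfl := Finset.mem_singleton.1 (Finsupp.support_single_subset hf)
    exact .refl
  | tail _ h ih =>
    obtain ⟨g, E₀, F, hr, rfl, rfl⟩ := h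
    rcases Finset.mem_union.1 (Finsupp.support_add hf) with hf | hf
    · exact (ih (by simp)).tail (hr.eStep hf)
    · exact ih (by simp at hf ⊢; omega)

theorem EStep.steps_inl {s : ResTerm} {f : ResExpr} (h : Relation.ReflTransGen EStep (.inl s) f) :
    ∃ s', f = .inl s' ∧ Steps s s' := by
  induction h with
  | refl => exact ⟨s, rfl, .refl⟩
  | tail _ h ih =>
    obtain ⟨s', rfl, h1⟩ := ih
    cases h with | inl h => exact ⟨_, rfl, h1.tail h⟩

theorem EStep.steps_inr {m : Multiset ResTerm} {f : ResExpr}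
    (h : Relation.ReflTransGen EStep (.inr m) f) : ∃ m', f = .inr m' ∧ m.Rel Steps m' := by
  induction h with
  | refl => exact ⟨m, rfl, Multiset.rel_refl_of_refl_on fun _ _ => .refl⟩
  | tail _ h ih =>
    obtain ⟨m', rfl, h1⟩ := ih
    cases h with
    | inr h =>
      obtain ⟨t, h⟩ := h
      obtain ⟨p, m, h2, h3, rfl⟩ := Multiset.rel_cons_right.1 h1
      exact ⟨_, rfl, .cons (h2.tail h) h3⟩

/-- A sum none of whose summands is reducible. -/
def IsNormal (E : ResExpr →₀ ℕ) : Prop := ∀ e ∈ E.support, ∀ E₀, ¬ Red e E₀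

theorem isNormal_iff {E : ResExpr →₀ ℕ} : IsNormal E ↔ ∀ E', ¬ RedS E E' := by
  constructor
  · rintro h E' ⟨e, E₀, F, hr, rfl, rfl⟩
    exact h e (by simp) E₀ hr
  · intro h e he E₀ hr
    refine h _ ⟨e, E₀, E - Finsupp.single e 1, hr, ?_, rfl⟩
    refine (add_tsub_cancel_of_le ?_).symm
    rw [Finsupp.single_le_iff]
    exact Nat.one_le_iff_ne_zero.2 (Finsupp.mem_support_iff.1 he)

theorem RedS.add_right {E E' : ResExpr →₀ ℕ} (h : RedS E E') (G : ResExpr →₀ ℕ) :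
    RedS (E + G) (E' + G) := by
  obtain ⟨e, E₀, F, hr, rfl, rfl⟩ := h
  exact ⟨e, E₀, F + G, hr, add_assoc _ _ _, add_assoc _ _ _⟩

/-- A sum which reduces to a normal one. -/
def HasNormalForm (E : ResExpr →₀ ℕ) : Prop :=
  ∃ N, Relation.ReflTransGen RedS E N ∧ IsNormal N

theorem HasNormalForm.add {E F : ResExpr →₀ ℕ} (hE : HasNormalForm E) (hF : HasNormalForm F) :
    HasNormalForm (E + F) := by
  classical
  obtain ⟨N, h1, h2⟩ := hE
  obtain ⟨M, h3, h4⟩ := hF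
  refine ⟨N + M, .trans (b := N + F) (h1.lift (· + F) fun _ _ h => h.add_right F) ?_, ?_⟩
  · rw [add_comm N F, add_comm N M]
    exact h3.lift (· + N) fun _ _ h => h.add_right N
  · intro e he
    exact (Finset.mem_union.1 (Finsupp.support_add he)).elim (h2 e) (h4 e)

theorem HasNormalForm.zero : HasNormalForm 0 := ⟨0, .refl, by simp [IsNormal]⟩

theorem HasNormalForm.of_support {E : ResExpr →₀ ℕ}
    (h : ∀ e ∈ E.support, HasNormalForm (Finsupp.single e 1)) : HasNormalForm E := by
  rw [← Finsupp.sum_single E]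
  refine Finset.sum_induction _ HasNormalForm (fun _ _ => .add) .zero fun e he => ?_
  induction E e with
  | zero => simpa using HasNormalForm.zero
  | succ n ih => rw [Finsupp.single_add]; exact ih.add (h e he)

theorem StepM.weight {t t' : Multiset ResTerm} (h : StepM t t') : mWeight 1 t' < mWeight 1 t ∨
    (mWeight 1 t' = mWeight 1 t ∧ mWeight 2 t' < mWeight 2 t) := by
  obtain ⟨t, h⟩ := h
  have := h.smaller
  unfold Smaller at this
  simp
  omega

theorem EStep.wf : WellFounded fun f e => EStep e f := by
  refine Subrelation.wf (r := InvImage (Prod.Lex (· < ·) (· < ·)) fun e =>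
    (Sum.elim (qWeight 1) (mWeight 1) e, Sum.elim (qWeight 2) (mWeight 2) e)) (fun {f e} h => ?_)
    (InvImage.wf _ (IsWellFounded.wf : WellFounded (Prod.Lex (· < · : ℕ → ℕ → Prop) (· < ·))))
  cases h with
  | inl h => simpa [InvImage, Prod.lex_def, Smaller] using h.smaller
  | inr h => simpa [InvImage, Prod.lex_def] using h.weight

theorem hasNormalForm_single (e : ResExpr) : HasNormalForm (Finsupp.single e 1) := by
  induction e using EStep.wf.induction with
  | h e IH =>
  by_cases h : ∃ E, Red e E
  · obtain ⟨E, h⟩ := h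
    obtain ⟨N, h1, h2⟩ := HasNormalForm.of_support fun f hf => IH f (h.eStep hf)
    exact ⟨N, .head ⟨e, E, 0, h, by simp, by simp⟩ h1, h2⟩
  · refine ⟨_, .refl, fun f hf E hE => h ⟨E, ?_⟩⟩
    obtain rfl := Finset.mem_singleton.1 (Finsupp.support_single_subset hf)
    exact hE

theorem NF_spec (e : ResExpr) :
    Relation.ReflTransGen RedS (Finsupp.single e 1) (NF e) ∧ ∀ E', ¬ RedS (NF e) E' := by
  obtain ⟨N, h1, h2⟩ := hasNormalForm_single e
  exact Classical.epsilon_spec (p := fun E =>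
    Relation.ReflTransGen RedS (Finsupp.single e 1) E ∧ ∀ E', ¬ RedS E E') ⟨N, h1, isNormal_iff.1 h2⟩

theorem CohT.coh {a a' : Rt} (h : CohT a a') : Coh (rmk a) (rmk a') := by
  induction h using CohT.rec (motive_2 := fun ds ds' _ =>
    ∀ b ∈ toMul ds + toMul ds', ∀ b' ∈ toMul ds + toMul ds', Coh b b') with
  | var x => exact .var x
  | lam _ ih => rw [rmk_lam, rmk_lam]; exact .lam ih
  | inl _ ih => rw [rmk_inl, rmk_inl]; exact .inj _ ih
  | inr _ ih => rw [rmk_inr, rmk_inr]; exact .inj _ ih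
  | mix a a' => rw [rmk_inl, rmk_inr]; exact .mix _ _ (by simp)
  | app _ _ ih ih' => rw [rmk_app, rmk_app]; exact .app ih ih'
  | mk _ ih =>
    rename_i ds ds' _ _ hb _ hb'
    have hm : ∀ b ∈ toMul ds + toMul ds', ∃ d ∈ ds ++ ds', rmk d = b := fun b hb => by
      rw [← mem_toMul]
      simpa [toMul] using hb
    obtain ⟨d, hd, rfl⟩ := hm _ hb
    obtain ⟨d', hd', rfl⟩ := hm _ hb'
    exact ih d hd d' hd'

theorem CohM.coh {ds ds' : List Rt} (h : CohM ds ds') :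
    ∀ b ∈ toMul ds, ∀ b' ∈ toMul ds', Coh b b' := by
  obtain ⟨H⟩ := h
  intro b hb b' hb'
  obtain ⟨d, hd, rfl⟩ := mem_toMul.1 hb
  obtain ⟨d', hd', rfl⟩ := mem_toMul.1 hb'
  exact (H d (by simp [hd]) d' (by simp [hd'])).coh


/-! ### STATEMENT 18:
Let `e, e'` be coherent resource expressions. If the supports of their
`→∂`-normal forms intersect, then `e = e'`. -/
theorem NF_supports_disjoint_of_coherent (e e' : ResExpr) (h : CohQE e e')
    (hne : ∃ a, a ∈ (NF e).support ∧ a ∈ (NF e').support) : e = e' := by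
  obtain ⟨a, ha, ha'⟩ := hne
  have h1 := RedS.eSteps (NF_spec e).1 ha
  have h2 := RedS.eSteps (NF_spec e').1 ha'
  have hn := isNormal_iff.2 (NF_spec e).2 a ha
  match e, e', h with
  | .inl s, .inl s', h =>
    obtain ⟨b, b', rfl, rfl, h⟩ := h
    obtain ⟨c, rfl, h3⟩ := EStep.steps_inl h1
    obtain ⟨c', e, h4⟩ := EStep.steps_inl h2
    obtain rfl := Sum.inl_injective e
    rw [h.coh.eq_of_steps h3 h4 fun hr => hr.exists_red.elim hn]
  | .inr m, .inr m', h =>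
    obtain ⟨bs, bs', rfl, rfl, h⟩ := h
    obtain ⟨w, rfl, h3⟩ := EStep.steps_inr h1
    obtain ⟨w', e, h4⟩ := EStep.steps_inr h2
    obtain rfl := Sum.inr_injective e
    rw [Multiset.eq_of_rel h3 h4 fun p hp q hq c hc hpc hqc =>
      (h.coh p hp q hq).eq_of_steps hpc hqc fun hr => by
        obtain ⟨w, rfl⟩ := Multiset.exists_cons_of_mem hc
        obtain ⟨E, hE⟩ := hr.exists_red
        exact hn _ (.monCtx w hE)]
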